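/- arXiv:math/9805038 — 2 statements merged into one kernel-verified Lean document; each statement's English description precedes it below -/
import Mathlib

section
/- Let n ≥ 2 be even and let 1 < p < ∞. Let V be a real-linear subspace of ℂⁿ of real dimension n−1 such that s(v) ≠ 0 for every nonzero v ∈ V, and let ν ∈ ℂⁿ be a fixed vector satisfying Σ_{j=1}^n v_j ν_j = 0 for all v ∈ V. Let μ denote the (n−1)-dimensional Hausdorff measure on ℂⁿ (regarded as the 2n-dimensional real Euclidean space with norm ‖z‖² = Σ_j |z_j|²) restricted to V. Then there exists a constant C > 0 such that for every f ∈ L^p(μ; Cl_n(ℂ)) the truncated singular integrals C_ε f(z) = (1/ω_n) ∫_{{w ∈ V : ‖w−z‖ > ε}} G(z−w)·ι(ν)·f(w) dμ(w), for z ∈ V, converge in L^p(μ)-norm as ε → 0⁺ to a limit C_V f, and ‖C_V f‖_{L^p(μ)} ≤ C ‖f‖_{L^p(μ)}. In particular the principal value Cauchy transform defines a bounded linear operator C_V : L^p(V) → L^p(V). -/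
/-!
STATEMENT 0: Lᵖ-boundedness of the principal value Cauchy transform over a real
(n−1)-dimensional subspace `V` of ℂⁿ avoiding the null cone.

`Cl n` is the Clifford algebra over ℂ of the quadratic form `Q z = -(z₁² + ⋯ + zₙ²)` on ℂⁿ
(with the Euclidean metric, i.e. `EuclideanSpace ℂ (Fin n)`), with structure map `ιC`.
Since Mathlib has no canonical norm on a Clifford algebra, the statement quantifies over an
arbitrary norm on `Cl n` compatible with its canonical ℂ-vector space structure; as
`Cl n` is finite dimensional, all such norms are equivalent, so this is equivalent to the
intended statement.
-/

noncomputable section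
open MeasureTheory
open scoped BigOperators ENNReal

abbrev Cn (n : ℕ) := EuclideanSpace ℂ (Fin n)
abbrev Rn (n : ℕ) := EuclideanSpace ℝ (Fin n)

instance (n : ℕ) : MeasurableSpace (Cn n) := borel (Cn n)
instance (n : ℕ) : BorelSpace (Cn n) := ⟨rfl⟩

/-- `s z = z₁² + ⋯ + zₙ²`. -/
def sC (n : ℕ) (z : Cn n) : ℂ := ∑ j, z j ^ 2

/-- The quadratic form `Q z = -(z₁² + ⋯ + zₙ²)` on ℂⁿ. -/
def Qf (n : ℕ) : QuadraticForm ℂ (Cn n) :=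
  (QuadraticMap.weightedSumSquares ℂ (fun _ : Fin n => (-1 : ℂ))).comp
    (WithLp.linearEquiv 2 ℂ (Fin n → ℂ)).toLinearMap

/-- The complex Clifford algebra `Cl_n(ℂ)`. -/
abbrev Cl (n : ℕ) := CliffordAlgebra (Qf n)

/-- The structure map `ι : ℂⁿ → Cl_n(ℂ)`. -/
def ιC (n : ℕ) : Cn n →ₗ[ℂ] Cl n := CliffordAlgebra.ι (Qf n)

/-- The complex Cauchy kernel `G(z) = s(z)^{-n/2} • ι(z)` (for `n` even). -/
def Gc (n : ℕ) (z : Cn n) : Cl n := ((sC n z) ^ (n / 2))⁻¹ • ιC n z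

/-- `ω_n`: the (n−1)-dimensional Hausdorff measure of the unit sphere in ℝⁿ. -/
def ωn (n : ℕ) : ℝ := (μH[(n : ℝ) - 1] (Metric.sphere (0 : Rn n) 1)).toReal

/-- The (n−1)-dimensional Hausdorff measure on ℂⁿ (with its Euclidean metric),
restricted to the subspace `V`. -/
def μV (n : ℕ) (V : Submodule ℝ (Cn n)) : Measure (Cn n) :=
  (μH[(n : ℝ) - 1]).restrict (V : Set (Cn n))

/-- The truncated Cauchy transform
`C_ε f (z) = (1/ω_n) ∫_{w ∈ V, ‖w - z‖ > ε} G(z-w) · ι(ν) · f(w) dμ(w)`. -/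
def truncCauchy (n : ℕ) [NormedAddCommGroup (Cl n)] [NormedSpace ℂ (Cl n)]
    (V : Submodule ℝ (Cn n)) (ν : Cn n) (ε : ℝ) (f : Cn n → Cl n) (z : Cn n) : Cl n :=
  ((ωn n : ℂ))⁻¹ •
    ∫ w in {w : Cn n | ε < ‖w - z‖}, Gc n (z - w) * ιC n ν * f w ∂(μV n V)

/-- The conclusion: the truncated Cauchy integrals `C_ε f` converge in `Lᵖ`-norm as
`ε → 0⁺` to `T f` for a bounded (continuous) linear operator `T` on `Lᵖ(V)`. -/
def PVCauchyTransformBoundedOnLp (n : ℕ) (p : ℝ≥0∞) [Fact (1 ≤ p)]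
    (V : Submodule ℝ (Cn n)) (ν : Cn n)
    [NormedAddCommGroup (Cl n)] [NormedSpace ℂ (Cl n)]
    [MeasurableSpace (Cl n)] [BorelSpace (Cl n)] : Prop :=
  ∃ T : Lp (Cl n) p (μV n V) →L[ℂ] Lp (Cl n) p (μV n V),
    (∀ f : Lp (Cl n) p (μV n V),
      Filter.Tendsto
        (fun ε : ℝ =>
          eLpNorm (fun z : Cn n => truncCauchy n V ν ε (⇑f) z - (T f : Cn n → Cl n) z)
            p (μV n V))
        (nhdsWithin (0 : ℝ) (Set.Ioi 0)) (nhds 0)) ∧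
    ∃ C : ℝ, 0 < C ∧ ∀ f : Lp (Cl n) p (μV n V), ‖T f‖ ≤ C * ‖f‖

section
theorem exists_norm_rpow_le_sub_re_cpow {p : ℝ} (hp : 1 < p) (hp2 : p ≤ 2) :
    ∃ A B : ℝ, 0 ≤ A ∧ 0 ≤ B ∧ ∀ z : ℂ, 0 < z.re →
      ‖z‖ ^ p ≤ A * z.re ^ p - B * (z ^ (p : ℂ)).re := by
  have hpi := Real.pi_pos
  set θ := Real.pi * (1 + 1 / p) / 4 with hθ
  have hpθ : p * θ = Real.pi * (p + 1) / 4 := by rw [hθ]; field_simp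
  have h1p : 1 / p < 1 := by rw [div_lt_one (by linarith)]; exact hp
  have h1p0 : 0 < 1 / p := by positivity
  have hθ0 : 0 < θ := by positivity
  have hθ1 : θ < Real.pi / 2 := by rw [hθ]; nlinarith
  have hcθ : 0 < Real.cos θ := Real.cos_pos_of_mem_Ioo ⟨by linarith, hθ1⟩
  have hδ : Real.cos (p * θ) < 0 := by
    rw [hpθ]
    apply Real.cos_neg_of_pi_div_two_lt_of_lt <;> nlinarith
  set δ := -Real.cos (p * θ) with hδd
  have hδ0 : 0 < δ := by linarith
  refine ⟨(1 + δ⁻¹) / Real.cos θ ^ p, δ⁻¹, by positivity, by positivity, fun z hz => ?_⟩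
  have hz0 : z ≠ 0 := by rintro rfl; simp at hz
  have harg : |z.arg| < Real.pi / 2 := by rw [Complex.abs_arg_lt_pi_div_two_iff]; exact Or.inl hz
  have hre : z.re = ‖z‖ * Real.cos z.arg := by
    rw [Complex.cos_arg hz0]; field_simp
  have hcos : 0 < Real.cos z.arg := Real.cos_pos_of_mem_Ioo (abs_lt.1 harg |>.imp (by intro; linarith) id)
  rw [Complex.cpow_ofReal_re, hre, Real.mul_rpow (norm_nonneg _) hcos.le]
  have hzp : 0 ≤ ‖z‖ ^ p := by positivity
  suffices h : 1 ≤ (1 + δ⁻¹) / Real.cos θ ^ p * Real.cos z.arg ^ p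
      - δ⁻¹ * Real.cos (z.arg * p) by nlinarith
  rw [← Real.cos_abs (z.arg * p), ← Real.cos_abs z.arg, abs_mul, abs_of_pos (by linarith : 0 < p)]
  rw [← Real.cos_abs z.arg] at hcos
  have ha0 := abs_nonneg z.arg
  generalize |z.arg| = a at *
  rcases le_total a θ with h | h
  · have h1 : Real.cos θ ≤ Real.cos a :=
      Real.cos_le_cos_of_nonneg_of_le_pi ha0 (by linarith) h
    have h2 : 1 ≤ Real.cos a ^ p / Real.cos θ ^ p := by
      rw [one_le_div (by positivity)]; gcongr
    have h3 := Real.cos_le_one (a * p)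
    have h4 : 0 < δ⁻¹ := by positivity
    calc (1 : ℝ) = (1 + δ⁻¹) * 1 - δ⁻¹ * 1 := by ring
      _ ≤ (1 + δ⁻¹) * (Real.cos a ^ p / Real.cos θ ^ p) - δ⁻¹ * Real.cos (a * p) := by
        gcongr
      _ = _ := by ring
  · have h1 : Real.cos (a * p) ≤ -δ := by
      rw [hδd, neg_neg]
      apply Real.cos_le_cos_of_nonneg_of_le_pi (by positivity) (by nlinarith) (by nlinarith)
    have h4 : 0 < δ⁻¹ := by positivity
    have h5 : δ⁻¹ * δ = 1 := by field_simp
    have h6 : 0 ≤ (1 + δ⁻¹) / Real.cos θ ^ p * Real.cos a ^ p := by positivity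
    nlinarith

/-- `i` times the Cauchy integral of `f`; its real and imaginary parts are the (unnormalised)
Poisson and conjugate Poisson integrals of `f`. -/
def cauchyInt (f : ℝ → ℝ) (z : ℂ) : ℂ := ∫ t : ℝ, (f t : ℂ) * (Complex.I / (z - t))

theorem I_div_sub_ofReal (z : ℂ) (t : ℝ) : Complex.I / (z - t) =
    ⟨z.im / ((z.re - t) ^ 2 + z.im ^ 2), (z.re - t) / ((z.re - t) ^ 2 + z.im ^ 2)⟩ := by
  apply Complex.ext <;> simp [Complex.div_re, Complex.div_im, Complex.normSq_apply] <;> ring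

theorem sub_ofReal_ne_zero {z : ℂ} (hz : 0 < z.im) (t : ℝ) : z - t ≠ 0 := by
  intro h
  have := congrArg Complex.im h
  simp at this
  linarith

variable {f : ℝ → ℝ}

theorem cauchyInt_integrable (hf : Continuous f) (hc : HasCompactSupport f) {z : ℂ}
    (hz : 0 < z.im) : Integrable fun t : ℝ => (f t : ℂ) * (Complex.I / (z - t)) := by
  refine Continuous.integrable_of_hasCompactSupport ?_ ?_
  · refine (Complex.continuous_ofReal.comp hf).mul (continuous_const.div (by fun_prop) ?_)
    exact sub_ofReal_ne_zero hz
  · exact (hc.comp_left (g := fun x : ℝ => (x : ℂ)) (by simp)).mul_right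

theorem cauchyInt_re (hf : Continuous f) (hc : HasCompactSupport f) {z : ℂ} (hz : 0 < z.im) :
    (cauchyInt f z).re = ∫ t, f t * (z.im / ((z.re - t) ^ 2 + z.im ^ 2)) := by
  have := integral_re (cauchyInt_integrable hf hc hz)
  simp only [RCLike.re_to_complex] at this
  rw [cauchyInt, ← this]
  simp [I_div_sub_ofReal]

theorem cauchyInt_im (hf : Continuous f) (hc : HasCompactSupport f) {z : ℂ} (hz : 0 < z.im) :
    (cauchyInt f z).im = ∫ t, f t * ((z.re - t) / ((z.re - t) ^ 2 + z.im ^ 2)) := by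
  have := integral_im (cauchyInt_integrable hf hc hz)
  simp only [RCLike.im_to_complex] at this
  rw [cauchyInt, ← this]
  simp [I_div_sub_ofReal]

theorem cauchyInt_re_pos (hf : Continuous f) (hc : HasCompactSupport f) (h0 : ∀ t, 0 ≤ f t)
    (hne : ∃ t, f t ≠ 0) {z : ℂ} (hz : 0 < z.im) : 0 < (cauchyInt f z).re := by
  rw [cauchyInt_re hf hc hz]
  have hpos : ∀ t, 0 < (z.re - t) ^ 2 + z.im ^ 2 := fun t => by positivity
  obtain ⟨t, ht⟩ := hne
  refine Continuous.integral_pos_of_hasCompactSupport_nonneg_nonzero (x := t) ?_ ?_ ?_ ?_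
  · exact hf.mul (continuous_const.div (by fun_prop) fun t => (hpos t).ne')
  · exact hc.mul_right
  · intro t; have := hpos t; have := h0 t; simp only [Pi.zero_apply]; positivity
  · have := hpos t; positivity

theorem cauchyInt_differentiableOn (hf : Continuous f) (hc : HasCompactSupport f) :
    DifferentiableOn ℂ (cauchyInt f) {z | 0 < z.im} := by
  intro z hz
  have hz : 0 < z.im := hz
  apply DifferentiableAt.differentiableWithinAt
  set s : Set ℂ := {w | z.im / 2 < w.im}
  have hs : IsOpen s := isOpen_lt continuous_const Complex.continuous_im
  have hfi : Integrable f := hf.integrable_of_hasCompactSupport hc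
  have hsz : s ∈ nhds z := hs.mem_nhds (by simp [s, hz])
  have him : ∀ w ∈ s, 0 < w.im := fun w hw => by simp only [s, Set.mem_ofPred_eq] at hw; linarith
  refine (hasDerivAt_integral_of_dominated_loc_of_deriv_le (μ := volume) (𝕜 := ℂ)
    (F := fun w (t : ℝ) => (f t : ℂ) * (Complex.I / (w - t)))
    (F' := fun w (t : ℝ) => (f t : ℂ) * (-Complex.I / (w - t) ^ 2))
    (bound := fun t => |f t| * ((z.im / 2) ^ 2)⁻¹) (x₀ := z) (s := s) hsz
    ?_ ?_ ?_ ?_ ?_ ?_).2.differentiableAt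
  · filter_upwards [hsz] with w hw using (cauchyInt_integrable hf hc (him w hw)).1
  · exact cauchyInt_integrable hf hc hz
  · refine Continuous.aestronglyMeasurable ((Complex.continuous_ofReal.comp hf).mul
      (continuous_const.div (by fun_prop) fun t => pow_ne_zero _ (sub_ofReal_ne_zero hz t)))
  · refine Filter.Eventually.of_forall fun t w hw => ?_
    rw [norm_mul, norm_div, norm_neg, Complex.norm_I, norm_pow, Complex.norm_real,
      Real.norm_eq_abs, one_div]
    have h1 : z.im / 2 ≤ ‖w - t‖ := by
      refine le_trans ?_ (Complex.abs_im_le_norm _)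
      simp only [Complex.sub_im, Complex.ofReal_im, sub_zero]
      exact le_trans (le_of_lt hw) (le_abs_self _)
    gcongr
  · exact hfi.abs.mul_const _
  · refine Filter.Eventually.of_forall fun t w hw => ?_
    have h := sub_ofReal_ne_zero (him w hw) t
    have := ((hasDerivAt_id w).sub_const (t : ℂ)).inv h
    have := (this.const_mul Complex.I).const_mul (f t : ℂ)
    refine this.congr_deriv ?_
    change (f t : ℂ) * (Complex.I * (-1 / (w - t) ^ 2)) = _
    ring

theorem norm_cauchyInt_le (hi : Integrable f) {r : ℝ} (hr : ∀ t, r < |t| → f t = 0)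
    {z : ℂ} (hz : 2 * r ≤ ‖z‖) :
    ‖cauchyInt f z‖ ≤ 2 * (∫ t, |f t|) / ‖z‖ := by
  have h : ∀ t, ‖(f t : ℂ) * (Complex.I / (z - t))‖ ≤ |f t| * (2 / ‖z‖) := by
    intro t
    by_cases ht : r < |t|
    · simp [hr t ht]
    rw [norm_mul, norm_div, Complex.norm_I, Complex.norm_real, Real.norm_eq_abs]
    have h1 : ‖z‖ / 2 ≤ ‖z - t‖ := by
      have := norm_sub_norm_le z t
      rw [Complex.norm_real, Real.norm_eq_abs] at this
      linarith
    rcases (norm_nonneg z).eq_or_lt with h0 | h0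
    · have : z = 0 := norm_eq_zero.1 h0.symm
      subst this
      have : t = 0 := by
        rw [← abs_eq_zero]; have := abs_nonneg t; simp at hz; push Not at ht; linarith
      simp [this]
    refine mul_le_mul_of_nonneg_left ?_ (abs_nonneg _)
    rw [div_le_div_iff₀ (by linarith) h0]
    linarith
  refine (norm_integral_le_of_norm_le (hi.abs.mul_const _)
    (Filter.Eventually.of_forall h)).trans (le_of_eq ?_)
  rw [integral_mul_const]; ring
end

section
variable {f : ℝ → ℝ}

theorem norm_integral_cauchyInt_cpow_le (hf : Continuous f) (hc : HasCompactSupport f)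
    (h0 : ∀ t, 0 ≤ f t) (hne : ∃ t, f t ≠ 0) {p : ℝ} (hp : 1 < p) {r : ℝ}
    (hr : ∀ t, r < |t| → f t = 0) {y R : ℝ} (hy : 0 < y) (hR : 0 < R) (hrR : 2 * r ≤ R) :
    ‖∫ x in (-R)..R, cauchyInt f (x + y * Complex.I) ^ (p : ℂ)‖
      ≤ 4 * R * (2 * (∫ t, |f t|) / R) ^ p := by
  set M := ∫ t, |f t| with hM
  have hM0 : 0 ≤ M := integral_nonneg fun t => abs_nonneg _
  have hd : DifferentiableOn ℂ (fun z => cauchyInt f z ^ (p : ℂ)) {z | 0 < z.im} := by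
    intro z hz
    refine DifferentiableWithinAt.cpow_const (cauchyInt_differentiableOn hf hc z hz) ?_
    exact Or.inl (cauchyInt_re_pos hf hc h0 hne hz)
  have hb : ∀ z : ℂ, R ≤ ‖z‖ → ‖cauchyInt f z ^ (p : ℂ)‖ ≤ (2 * M / R) ^ p := by
    intro z hz
    rw [Complex.norm_cpow_real]
    refine Real.rpow_le_rpow (norm_nonneg _) ?_ (by linarith)
    refine (norm_cauchyInt_le (hf.integrable_of_hasCompactSupport hc) hr (hrR.trans hz)).trans ?_
    gcongr
  have key := Complex.integral_boundary_rect_eq_zero_of_differentiableOn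
    (fun z => cauchyInt f z ^ (p : ℂ)) ⟨-R, y⟩ ⟨R, y + R⟩ (hd.mono fun z hz => by
      have := hz.2
      simp only [Set.mem_preimage] at this
      rw [Set.uIcc_of_le (by linarith)] at this
      exact lt_of_lt_of_le hy this.1)
  simp only at key
  set a := ∫ x in (-R)..R, cauchyInt f (x + y * Complex.I) ^ (p : ℂ)
  set b := ∫ x in (-R)..R, cauchyInt f (x + (y + R : ℝ) * Complex.I) ^ (p : ℂ)
  set c := ∫ t in y..(y + R), cauchyInt f ((R : ℝ) + t * Complex.I) ^ (p : ℂ)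
  set d := ∫ t in y..(y + R), cauchyInt f ((-R : ℝ) + t * Complex.I) ^ (p : ℂ)
  have hab : a = b - Complex.I • c + Complex.I • d := by linear_combination key
  have hbn : ‖b‖ ≤ (2 * M / R) ^ p * |R - -R| := by
    refine intervalIntegral.norm_integral_le_of_norm_le_const fun x _ => hb _ ?_
    refine le_trans ?_ (Complex.abs_im_le_norm _)
    simp only [Complex.add_im, Complex.ofReal_im, Complex.mul_im, Complex.ofReal_re, Complex.I_re,
      Complex.I_im]
    rw [abs_of_nonneg] <;> linarith
  have hcn : ‖c‖ ≤ (2 * M / R) ^ p * |y + R - y| := by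
    refine intervalIntegral.norm_integral_le_of_norm_le_const fun x _ => hb _ ?_
    refine le_trans ?_ (Complex.abs_re_le_norm _)
    simp [abs_of_pos hR]
  have hdn : ‖d‖ ≤ (2 * M / R) ^ p * |y + R - y| := by
    refine intervalIntegral.norm_integral_le_of_norm_le_const fun x _ => hb _ ?_
    refine le_trans ?_ (Complex.abs_re_le_norm _)
    simp [abs_of_pos hR]
  have e1 : |R - -R| = 2 * R := by rw [abs_of_nonneg] <;> linarith
  have e2 : |y + R - y| = R := by rw [abs_of_nonneg] <;> linarith
  rw [e1] at hbn
  rw [e2] at hcn hdn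
  rw [hab]
  calc _ ≤ ‖b‖ + ‖c‖ + ‖d‖ := by
        refine (norm_add_le _ _).trans ?_
        have := norm_sub_le b (Complex.I • c)
        simp only [norm_smul, Complex.norm_I, one_mul] at this ⊢
        linarith
    _ ≤ _ := by linarith

theorem lintegral_cauchyInt_im_le {p A B : ℝ} (hp : 1 < p) (hA : 0 ≤ A) (hB : 0 ≤ B)
    (hAB : ∀ z : ℂ, 0 < z.re → ‖z‖ ^ p ≤ A * z.re ^ p - B * (z ^ (p : ℂ)).re)
    (hf : Continuous f) (hc : HasCompactSupport f) (h0 : ∀ t, 0 ≤ f t) (hne : ∃ t, f t ≠ 0)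
    {y : ℝ} (hy : 0 < y) :
    ∫⁻ x : ℝ, ‖(cauchyInt f (x + y * Complex.I)).im‖ₑ ^ p
      ≤ ENNReal.ofReal A * ∫⁻ x : ℝ, ‖(cauchyInt f (x + y * Complex.I)).re‖ₑ ^ p := by
  obtain ⟨r, hr⟩ : ∃ r, ∀ t, r < |t| → f t = 0 := by
    obtain ⟨r, hr⟩ := hc.isCompact.isBounded.subset_closedBall 0
    refine ⟨r, fun t ht => image_eq_zero_of_notMem_tsupport fun h => ?_⟩
    have := hr h
    simp at this
    linarith
  set M := ∫ t, |f t| with hM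
  have hM0 : 0 ≤ M := integral_nonneg fun t => abs_nonneg _
  set F : ℝ → ℂ := fun x => cauchyInt f (x + y * Complex.I) with hF
  have him : ∀ x : ℝ, 0 < (x + y * Complex.I : ℂ).im := fun x => by simpa using hy
  have hFc : Continuous F := by
    refine (cauchyInt_differentiableOn hf hc).continuousOn.comp_continuous (by fun_prop) him
  have hpos : ∀ x, 0 < (F x).re := fun x => cauchyInt_re_pos hf hc h0 hne (him x)
  have hGc : Continuous fun x => F x ^ (p : ℂ) := by
    refine continuous_iff_continuousAt.2 fun x => ?_
    exact hFc.continuousAt.cpow continuousAt_const (Or.inl (hpos x))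
  have hrec : Continuous fun x => (F x).re ^ p :=
    (Complex.continuous_re.comp hFc).rpow_const fun x => Or.inr (by linarith)
  have hnc : Continuous fun x => ‖F x‖ ^ p := hFc.norm.rpow_const fun x => Or.inr (by linarith)
  have hR : ∀ R : ℝ, 0 < R → 2 * r ≤ R →
      ∫⁻ x in Set.Ioc (-R) R, ‖(F x).im‖ₑ ^ p ≤
        ENNReal.ofReal A * (∫⁻ x : ℝ, ‖(F x).re‖ₑ ^ p)
          + ENNReal.ofReal (B * (4 * R * (2 * M / R) ^ p)) := by
    intro R hR hrR
    have h1 := norm_integral_cauchyInt_cpow_le hf hc h0 hne hp hr hy hR hrR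
    have hle : -R ≤ R := by linarith
    have h2 : ∫ x in (-R)..R, ‖F x‖ ^ p ≤
        A * (∫ x in (-R)..R, (F x).re ^ p) - B * ∫ x in (-R)..R, (F x ^ (p : ℂ)).re := by
      rw [← intervalIntegral.integral_const_mul, ← intervalIntegral.integral_const_mul,
        ← intervalIntegral.integral_sub]
      · refine intervalIntegral.integral_mono_on hle ?_ ?_ fun x _ => hAB _ (hpos x)
        · exact hnc.intervalIntegrable _ _
        · exact ((hrec.const_mul A).sub ((Complex.continuous_re.comp hGc).const_mul B)
            ).intervalIntegrable _ _
      · exact (hrec.const_mul A).intervalIntegrable _ _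
      · exact ((Complex.continuous_re.comp hGc).const_mul B).intervalIntegrable _ _
    have h3 : |∫ x in (-R)..R, (F x ^ (p : ℂ)).re| ≤ 4 * R * (2 * M / R) ^ p := by
      refine le_trans ?_ h1
      have := intervalIntegral.intervalIntegral_re (𝕜 := ℂ) (μ := volume)
        (hGc.intervalIntegrable (-R) R)
      simp only [RCLike.re_to_complex] at this
      rw [this]
      exact Complex.abs_re_le_norm _
    have h4 : ∫ x in (-R)..R, ‖F x‖ ^ p ≤
        A * (∫ x in (-R)..R, (F x).re ^ p) + B * (4 * R * (2 * M / R) ^ p) := by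
      have := mul_le_mul_of_nonneg_left (neg_le_of_abs_le h3) hB
      linarith
    have h5 : ENNReal.ofReal (∫ x in (-R)..R, (F x).re ^ p) ≤ ∫⁻ x : ℝ, ‖(F x).re‖ₑ ^ p := by
      rw [intervalIntegral.integral_of_le hle, ofReal_integral_eq_lintegral_ofReal]
      · refine (setLIntegral_le_lintegral _ _).trans (lintegral_mono fun x => ?_)
        rw [← ENNReal.ofReal_rpow_of_pos (hpos x), Real.enorm_of_nonneg (hpos x).le]
      · exact hrec.integrableOn_Ioc
      · exact Filter.Eventually.of_forall fun x => Real.rpow_nonneg (hpos x).le _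
    calc ∫⁻ x in Set.Ioc (-R) R, ‖(F x).im‖ₑ ^ p
        ≤ ∫⁻ x in Set.Ioc (-R) R, ENNReal.ofReal (‖F x‖ ^ p) := by
          refine lintegral_mono fun x => ?_
          rw [← ENNReal.ofReal_rpow_of_nonneg (norm_nonneg _) (by linarith), ofReal_norm]
          refine ENNReal.rpow_le_rpow ?_ (by linarith)
          rw [enorm_le_iff_norm_le, Real.norm_eq_abs]
          exact Complex.abs_im_le_norm _
      _ = ENNReal.ofReal (∫ x in (-R)..R, ‖F x‖ ^ p) := by
          rw [intervalIntegral.integral_of_le hle, ofReal_integral_eq_lintegral_ofReal]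
          · exact hnc.integrableOn_Ioc
          · exact Filter.Eventually.of_forall fun x => by positivity
      _ ≤ _ := by
          refine (ENNReal.ofReal_le_ofReal h4).trans (ENNReal.ofReal_add_le.trans ?_)
          rw [ENNReal.ofReal_mul hA]
          gcongr
  have hlim : Filter.Tendsto (fun R : ℝ => ENNReal.ofReal A * (∫⁻ x : ℝ, ‖(F x).re‖ₑ ^ p)
          + ENNReal.ofReal (B * (4 * R * (2 * M / R) ^ p))) Filter.atTop
      (nhds (ENNReal.ofReal A * ∫⁻ x : ℝ, ‖(F x).re‖ₑ ^ p)) := by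
    conv => rhs; rw [← add_zero (ENNReal.ofReal A * _)]
    refine tendsto_const_nhds.add ?_
    rw [← ENNReal.ofReal_zero]
    refine ENNReal.tendsto_ofReal ?_
    have h := (tendsto_rpow_neg_atTop (y := p - 1) (by linarith)).const_mul (B * (4 * (2 * M) ^ p))
    rw [mul_zero] at h
    refine h.congr' ?_
    filter_upwards [Filter.eventually_gt_atTop 0] with R hR
    rw [Real.div_rpow (by positivity) hR.le, neg_sub, Real.rpow_sub hR, Real.rpow_one]
    ring
  have hmono : Filter.Tendsto (fun R : ℝ => ∫⁻ x in Set.Ioc (-R) R, ‖(F x).im‖ₑ ^ p)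
      Filter.atTop (nhds (∫⁻ x : ℝ, ‖(F x).im‖ₑ ^ p)) := by
    refine AECover.lintegral_tendsto_of_countably_generated
      (aecover_Ioc Filter.tendsto_neg_atTop_atBot Filter.tendsto_id) ?_
    have : Continuous fun x => (F x).im := Complex.continuous_im.comp hFc
    exact (this.measurable.enorm.pow_const _).aemeasurable
  refine le_of_tendsto_of_tendsto hmono hlim ?_
  filter_upwards [Filter.eventually_gt_atTop 0, Filter.eventually_ge_atTop (2 * r)] with R h1 h2
    using hR R h1 h2
end

theorem lintegral_mul_rpow_le {T : Type*} [MeasurableSpace T] {ν : Measure T} {k h : T → ℝ≥0∞}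
    (hk : AEMeasurable k ν) (hh : AEMeasurable h ν) {p : ℝ} (hp : 1 < p) :
    (∫⁻ t, k t * h t ∂ν) ^ p ≤ (∫⁻ t, k t ∂ν) ^ (p - 1) * ∫⁻ t, k t * h t ^ p ∂ν := by
  set q := p / (p - 1)
  have hpq : q.HolderConjugate p := (Real.HolderConjugate.conjExponent hp).symm
  have hp0 : 0 < p := by linarith
  have hq0 : 0 < q := hpq.pos
  have h1 := ENNReal.lintegral_mul_le_Lp_mul_Lq ν hpq (f := fun t => k t ^ (1 / q))
    (g := fun t => k t ^ (1 / p) * h t) (hk.pow_const _) ((hk.pow_const _).mul hh)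
  have e1 : ∀ t, ((fun t => k t ^ (1 / q)) * fun t => k t ^ (1 / p) * h t) t = k t * h t := by
    intro t
    simp only [Pi.mul_apply]
    rw [← mul_assoc, ← ENNReal.rpow_add_of_nonneg _ _ (by positivity) (by positivity)]
    have : 1 / q + 1 / p = 1 := by simpa using hpq.inv_add_inv_eq_one
    rw [this, ENNReal.rpow_one]
  have e2 : ∀ t, (k t ^ (1 / q)) ^ q = k t := fun t => by
    rw [← ENNReal.rpow_mul, one_div_mul_cancel hq0.ne', ENNReal.rpow_one]
  have e3 : ∀ t, (k t ^ (1 / p) * h t) ^ p = k t * h t ^ p := fun t => by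
    rw [ENNReal.mul_rpow_of_nonneg _ _ hp0.le, ← ENNReal.rpow_mul, one_div_mul_cancel hp0.ne',
      ENNReal.rpow_one]
  simp only [e1, e2, e3] at h1
  refine (ENNReal.rpow_le_rpow h1 hp0.le).trans (le_of_eq ?_)
  rw [ENNReal.mul_rpow_of_nonneg _ _ hp0.le, ← ENNReal.rpow_mul, ← ENNReal.rpow_mul,
    one_div_mul_cancel hp0.ne', ENNReal.rpow_one]
  congr 2
  simp only [q]; field_simp

/-- **Minkowski's integral inequality** for a weighted superposition of functions that are
uniformly bounded in `Lᵖ`. -/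
theorem eLpNorm_le_lintegral_mul_of_enorm_le {X T W W' : Type*} [MeasurableSpace X]
    [MeasurableSpace T] [NormedAddCommGroup W] [NormedAddCommGroup W']
    {μ : Measure X} {ν : Measure T} [SFinite μ] [SFinite ν]
    {p : ℝ≥0∞} (hp : 1 < p) (hp' : p < ∞) {k : T → ℝ≥0∞} (hk : Measurable k) {h : X → T → W}
    (hh : StronglyMeasurable (Function.uncurry h)) {F : X → W'}
    (hF : ∀ x, ‖F x‖ₑ ≤ ∫⁻ t, k t * ‖h x t‖ₑ ∂ν)
    {D : ℝ≥0∞} (hD : ∀ᵐ t ∂ν, eLpNorm (fun x => h x t) p μ ≤ D) :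
    eLpNorm F p μ ≤ (∫⁻ t, k t ∂ν) * D := by
  have hp0 : p ≠ 0 := (zero_lt_one.trans hp).ne'
  have hpr : 1 < p.toReal := by
    rw [← ENNReal.toReal_one]; exact (ENNReal.toReal_lt_toReal (by simp) hp'.ne).2 hp
  have hpr0 : 0 < p.toReal := by linarith
  have hhm : Measurable fun z : X × T => ‖h z.1 z.2‖ₑ := hh.enorm
  have key : ∫⁻ x, ‖F x‖ₑ ^ p.toReal ∂μ ≤ ((∫⁻ t, k t ∂ν) * D) ^ p.toReal := by
    calc ∫⁻ x, ‖F x‖ₑ ^ p.toReal ∂μ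
        ≤ ∫⁻ x, (∫⁻ t, k t ∂ν) ^ (p.toReal - 1) *
            ∫⁻ t, k t * ‖h x t‖ₑ ^ p.toReal ∂ν ∂μ := by
          refine lintegral_mono fun x => ?_
          refine (ENNReal.rpow_le_rpow (hF x) hpr0.le).trans ?_
          exact lintegral_mul_rpow_le hk.aemeasurable
            (hhm.comp measurable_prodMk_left).aemeasurable hpr
      _ = (∫⁻ t, k t ∂ν) ^ (p.toReal - 1) *
            ∫⁻ t, k t * ∫⁻ x, ‖h x t‖ₑ ^ p.toReal ∂μ ∂ν := by
          have hm : Measurable fun z : X × T => k z.2 * ‖h z.1 z.2‖ₑ ^ p.toReal :=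
            (hk.comp measurable_snd).mul (hhm.pow_const _)
          rw [lintegral_const_mul _ hm.lintegral_prod_right', lintegral_lintegral_swap hm.aemeasurable]
          congr 1
          refine lintegral_congr fun t => ?_
          have hmt : Measurable fun x => ‖h x t‖ₑ ^ p.toReal :=
            (hhm.comp measurable_prodMk_right).pow_const _
          exact lintegral_const_mul (k t) hmt
      _ ≤ (∫⁻ t, k t ∂ν) ^ (p.toReal - 1) * ∫⁻ t, k t * D ^ p.toReal ∂ν := by
          gcongr 1
          refine lintegral_mono_ae ?_
          filter_upwards [hD] with t ht
          gcongr
          rw [eLpNorm_eq_lintegral_rpow_enorm_toReal hp0 hp'.ne] at ht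
          have := ENNReal.rpow_le_rpow ht hpr0.le
          rwa [← ENNReal.rpow_mul, one_div_mul_cancel hpr0.ne', ENNReal.rpow_one] at this
      _ = _ := by
          rw [lintegral_mul_const _ hk, ENNReal.mul_rpow_of_nonneg _ _ hpr0.le, ← mul_assoc]
          congr 1
          nth_rw 2 [← ENNReal.rpow_one (∫⁻ t, k t ∂ν)]
          rw [← ENNReal.rpow_add_of_nonneg _ _ (by linarith) (by norm_num)]
          simp
  rw [eLpNorm_eq_lintegral_rpow_enorm_toReal hp0 hp'.ne]
  refine (ENNReal.rpow_le_rpow key (by positivity)).trans ?_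
  rw [← ENNReal.rpow_mul, mul_one_div_cancel hpr0.ne', ENNReal.rpow_one]

theorem lintegral_poissonKernel {y : ℝ} (hy : 0 < y) :
    ∫⁻ t : ℝ, ENNReal.ofReal (y / (t ^ 2 + y ^ 2)) = ENNReal.ofReal Real.pi := by
  have e : ∀ t : ℝ, y / (t ^ 2 + y ^ 2) = y⁻¹ * (1 + (y⁻¹ * t) ^ 2)⁻¹ := by
    intro t; field_simp; ring
  rw [← ofReal_integral_eq_lintegral_ofReal]
  · congr 1
    simp only [e]
    rw [integral_const_mul, Measure.integral_comp_mul_left (fun t => (1 + t ^ 2)⁻¹)]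
    simp [abs_of_pos hy]
    field_simp
  · simp only [e]
    exact (integrable_inv_one_add_sq.comp_mul_left' (inv_pos.2 hy).ne').const_mul _
  · exact Filter.Eventually.of_forall fun t => by positivity

/-- The (unnormalised) conjugate Poisson integral of `f` at height `y`. -/
def conjPoisson {W : Type*} [NormedAddCommGroup W] [NormedSpace ℝ W] (y : ℝ) (f : ℝ → W) (x : ℝ) :
    W := ∫ t : ℝ, (t / (t ^ 2 + y ^ 2)) • f (x - t)

section
variable {W : Type*} [NormedAddCommGroup W] [NormedSpace ℝ W] {f : ℝ → W}

theorem continuous_conjPoissonKernel {y : ℝ} (hy : 0 < y) :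
    Continuous fun t : ℝ => t / (t ^ 2 + y ^ 2) :=
  continuous_id.div (by fun_prop) fun t => by positivity

omit [NormedSpace ℝ W] in
theorem hasCompactSupport_comp_const_sub (hc : HasCompactSupport f) (x : ℝ) :
    HasCompactSupport fun t => f (x - t) :=
  hc.comp_homeomorph (Homeomorph.subLeft x)

theorem integrable_conjPoisson (hf : Continuous f) (hc : HasCompactSupport f) {y : ℝ}
    (hy : 0 < y) (x : ℝ) : Integrable fun t : ℝ => (t / (t ^ 2 + y ^ 2)) • f (x - t) :=
  ((continuous_conjPoissonKernel hy).smul (by fun_prop)).integrable_of_hasCompactSupport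
    (hasCompactSupport_comp_const_sub hc x).smul_left

theorem conjPoisson_eq_sub (y : ℝ) (x : ℝ) :
    conjPoisson y f x = ∫ t : ℝ, ((x - t) / ((x - t) ^ 2 + y ^ 2)) • f t := by
  rw [conjPoisson, ← integral_sub_left_eq_self _ _ x]
  simp

/-- The conjugate Poisson integrals are bounded on `Lᵖ(ℝ; W)`, uniformly in the height. -/
def ConjPoissonBound (W : Type*) [NormedAddCommGroup W] [NormedSpace ℝ W] (p C : ℝ≥0∞) : Prop :=
  ∀ y : ℝ, 0 < y → ∀ f : ℝ → W, Continuous f → HasCompactSupport f →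
    eLpNorm (conjPoisson y f) p volume ≤ C * eLpNorm f p volume

omit [NormedSpace ℝ W] in
theorem eLpNorm_poisson_le {p : ℝ≥0∞} (hp : 1 < p) (hp' : p < ∞) {y : ℝ} (hy : 0 < y)
    (hf : Continuous f) {W' : Type*} [NormedAddCommGroup W'] {F : ℝ → W'}
    (hF : ∀ x, ‖F x‖ₑ ≤ ∫⁻ t, ENNReal.ofReal (y / (t ^ 2 + y ^ 2)) * ‖f (x - t)‖ₑ) :
    eLpNorm F p volume ≤ ENNReal.ofReal Real.pi * eLpNorm f p volume := by
  rw [← lintegral_poissonKernel hy]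
  refine eLpNorm_le_lintegral_mul_of_enorm_le hp hp' (by fun_prop)
    (h := fun x t => f (x - t)) ?_ hF (Filter.Eventually.of_forall fun t => le_of_eq ?_)
  · exact (hf.comp (by fun_prop : Continuous fun z : ℝ × ℝ => z.1 - z.2)).stronglyMeasurable
  · exact eLpNorm_comp_measurePreserving hf.aestronglyMeasurable (measurePreserving_sub_right _ t)
end

theorem exists_conjPoissonBound_of_le_two {p : ℝ≥0∞} (hp : 1 < p) (hp2 : p ≤ 2) :
    ∃ C : ℝ≥0∞, C ≠ ∞ ∧ ConjPoissonBound ℝ p C := by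
  have hp' : p < ∞ := hp2.trans_lt (by simp)
  have hp0 : p ≠ 0 := (zero_lt_one.trans hp).ne'
  have hpr : 1 < p.toReal := by
    rw [← ENNReal.toReal_one]; exact (ENNReal.toReal_lt_toReal (by simp) hp'.ne).2 hp
  have hpr2 : p.toReal ≤ 2 := by
    have := ENNReal.toReal_mono (by simp) hp2
    simpa using this
  have hpr0 : 0 < p.toReal := by linarith
  obtain ⟨A, B, hA, hB, hAB⟩ := exists_norm_rpow_le_sub_re_cpow hpr hpr2
  set C := ENNReal.ofReal A ^ (1 / p.toReal) * ENNReal.ofReal Real.pi with hC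
  have hCt : C ≠ ∞ :=
    ENNReal.mul_ne_top (ENNReal.rpow_ne_top_of_nonneg (by positivity) (by simp)) (by simp)
  have nonneg_case : ∀ y : ℝ, 0 < y → ∀ f : ℝ → ℝ, Continuous f → HasCompactSupport f →
      (∀ t, 0 ≤ f t) → eLpNorm (conjPoisson y f) p volume ≤ C * eLpNorm f p volume := by
    intro y hy f hf hc h0
    by_cases hne : ∃ t, f t ≠ 0
    swap
    · push Not at hne
      have : f = 0 := funext hne
      subst this
      have : conjPoisson y (0 : ℝ → ℝ) = 0 := by ext x; simp [conjPoisson]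
      simp [this]
    have him : ∀ x : ℝ, 0 < (x + y * Complex.I : ℂ).im := fun x => by simpa using hy
    have e1 : ∀ x : ℝ, (cauchyInt f (x + y * Complex.I)).im = conjPoisson y f x := by
      intro x
      rw [cauchyInt_im hf hc (him x), conjPoisson_eq_sub]
      simp [mul_comm]
    have h := lintegral_cauchyInt_im_le hpr hA hB hAB hf hc h0 hne hy
    simp only [e1] at h
    have h2 : eLpNorm (conjPoisson y f) p volume ≤ ENNReal.ofReal A ^ (1 / p.toReal) *
        eLpNorm (fun x : ℝ => (cauchyInt f (x + y * Complex.I)).re) p volume := by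
      rw [eLpNorm_eq_lintegral_rpow_enorm_toReal hp0 hp'.ne,
        eLpNorm_eq_lintegral_rpow_enorm_toReal hp0 hp'.ne,
        ← ENNReal.mul_rpow_of_nonneg _ _ (by positivity)]
      exact ENNReal.rpow_le_rpow h (by positivity)
    refine h2.trans ?_
    rw [hC, mul_assoc]
    gcongr
    refine eLpNorm_poisson_le hp hp' hy hf fun x => ?_
    rw [cauchyInt_re hf hc (him x)]
    refine (enorm_integral_le_lintegral_enorm _).trans (le_of_eq ?_)
    rw [← lintegral_sub_left_eq_self _ x]
    refine lintegral_congr fun t => ?_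
    rw [enorm_mul, mul_comm]
    congr 1
    simp only [Complex.add_re, Complex.ofReal_re, Complex.mul_re, Complex.I_re, Complex.I_im,
      Complex.add_im, Complex.ofReal_im, Complex.mul_im]
    rw [Real.enorm_of_nonneg]
    · simp
    · have : 0 < y := hy
      simp; positivity
  refine ⟨C + C, by simp [hCt], fun y hy f hf hc => ?_⟩
  set f1 : ℝ → ℝ := fun t => max (f t) 0
  set f2 : ℝ → ℝ := fun t => max (-f t) 0
  have hf1 : Continuous f1 := hf.max continuous_const
  have hf2 : Continuous f2 := hf.neg.max continuous_const
  have hc1 : HasCompactSupport f1 := hc.comp_left (g := fun x : ℝ => max x 0) (by simp)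
  have hc2 : HasCompactSupport f2 := hc.comp_left (g := fun x : ℝ => max (-x) 0) (by simp)
  have e : conjPoisson y f = conjPoisson y f1 - conjPoisson y f2 := by
    ext x
    simp only [conjPoisson, Pi.sub_apply]
    rw [← integral_sub (integrable_conjPoisson hf1 hc1 hy x) (integrable_conjPoisson hf2 hc2 hy x)]
    refine integral_congr_ae (Filter.Eventually.of_forall fun t => ?_)
    simp only [← smul_sub, f1, f2]
    congr 1
    have := max_zero_sub_max_neg_zero_eq_self (f (x - t))
    exact this.symm
  have hm : ∀ g : ℝ → ℝ, Continuous g → AEStronglyMeasurable (conjPoisson y g) volume := by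
    intro g hg
    refine (StronglyMeasurable.integral_prod_right' (f := fun z : ℝ × ℝ =>
      (z.2 / (z.2 ^ 2 + y ^ 2)) • g (z.1 - z.2)) ?_).aestronglyMeasurable
    exact (((continuous_conjPoissonKernel hy).comp continuous_snd).smul
      (hg.comp (by fun_prop))).stronglyMeasurable
  rw [e, add_mul]
  refine (eLpNorm_sub_le (hm _ hf1) (hm _ hf2) hp.le).trans (add_le_add ?_ ?_)
  · refine (nonneg_case y hy f1 hf1 hc1 fun t => le_max_right _ _).trans ?_
    gcongr 1
    refine eLpNorm_mono fun t => ?_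
    rw [Real.norm_of_nonneg (le_max_right _ _)]
    exact max_le (Real.le_norm_self _) (norm_nonneg _)
  · refine (nonneg_case y hy f2 hf2 hc2 fun t => le_max_right _ _).trans ?_
    gcongr 1
    refine eLpNorm_mono fun t => ?_
    rw [Real.norm_of_nonneg (le_max_right _ _)]
    exact max_le (neg_le_abs _) (norm_nonneg _)

theorem abs_conjPoissonKernel_le {y : ℝ} (hy : 0 < y) (t : ℝ) : |t / (t ^ 2 + y ^ 2)| ≤ 1 / y := by
  rw [abs_div, abs_of_pos (by positivity : 0 < t ^ 2 + y ^ 2), div_le_div_iff₀ (by positivity) hy]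
  have := sq_abs t
  nlinarith [sq_nonneg (|t| - y), abs_nonneg t]

theorem continuous_conjPoisson {W : Type*} [NormedAddCommGroup W] [NormedSpace ℝ W] {f : ℝ → W}
    (hf : Continuous f) (hc : HasCompactSupport f) {y : ℝ} (hy : 0 < y) :
    Continuous (conjPoisson y f) := by
  have hk := continuous_conjPoissonKernel hy
  rw [show conjPoisson y f = fun x => ∫ t : ℝ, ((x - t) / ((x - t) ^ 2 + y ^ 2)) • f t from
    funext (conjPoisson_eq_sub y)]
  refine continuous_of_dominated (bound := fun t => 1 / y * ‖f t‖) (fun x => ?_) (fun x => ?_) ?_ ?_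
  · exact ((hk.comp (continuous_const.sub continuous_id)).smul hf).aestronglyMeasurable
  · refine Filter.Eventually.of_forall fun t => ?_
    rw [norm_smul, Real.norm_eq_abs]
    gcongr
    exact abs_conjPoissonKernel_le hy _
  · exact (hf.integrable_of_hasCompactSupport hc).norm.const_mul _
  · exact Filter.Eventually.of_forall fun t =>
      (hk.comp (continuous_id.sub continuous_const)).smul continuous_const

theorem integral_mul_conjPoisson {f g : ℝ → ℝ} (hf : Continuous f) (hfc : HasCompactSupport f)
    (hg : Continuous g) (hgc : HasCompactSupport g) {y : ℝ} (hy : 0 < y) :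
    ∫ x, g x * conjPoisson y f x = - ∫ t, f t * conjPoisson y g t := by
  have hk := continuous_conjPoissonKernel hy
  have hi : Integrable (Function.uncurry fun x t : ℝ =>
      g x * (((x - t) / ((x - t) ^ 2 + y ^ 2)) * f t)) (volume.prod volume) := by
    have h1 : Integrable (fun z : ℝ × ℝ => g z.1 * f z.2) (volume.prod volume) :=
      (hg.integrable_of_hasCompactSupport hgc).mul_prod (hf.integrable_of_hasCompactSupport hfc)
    have h2 := h1.bdd_mul (c := 1 / y)
      (f := fun z : ℝ × ℝ => (z.1 - z.2) / ((z.1 - z.2) ^ 2 + y ^ 2))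
      (hk.comp (continuous_fst.sub continuous_snd)).aestronglyMeasurable
      (Filter.Eventually.of_forall fun z => abs_conjPoissonKernel_le hy _)
    refine h2.congr (Filter.Eventually.of_forall fun z => ?_)
    simp only [Function.uncurry]
    ring
  calc ∫ x, g x * conjPoisson y f x
      = ∫ x, ∫ t, g x * (((x - t) / ((x - t) ^ 2 + y ^ 2)) * f t) := by
        refine integral_congr_ae (Filter.Eventually.of_forall fun x => ?_)
        simp only [conjPoisson_eq_sub, smul_eq_mul, integral_const_mul]
    _ = ∫ t, ∫ x, g x * (((x - t) / ((x - t) ^ 2 + y ^ 2)) * f t) := integral_integral_swap hi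
    _ = ∫ t, -(f t * conjPoisson y g t) := by
        refine integral_congr_ae (Filter.Eventually.of_forall fun t => ?_)
        simp only [conjPoisson_eq_sub, smul_eq_mul]
        rw [← integral_const_mul, ← integral_neg]
        refine integral_congr_ae (Filter.Eventually.of_forall fun x => ?_)
        simp only
        rw [show (x - t) ^ 2 = (t - x) ^ 2 by ring, show x - t = -(t - x) by ring]
        ring
    _ = _ := integral_neg _

theorem ENNReal.rpow_one_div_le_of_le_mul_rpow {p q : ℝ} (hpq : p.HolderConjugate q) {x a : ℝ≥0∞}
    (hx : x ≠ ∞) (h : x ≤ a * x ^ (1 / q)) : x ^ (1 / p) ≤ a := by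
  rcases eq_or_ne x 0 with rfl | hx0
  · rw [ENNReal.zero_rpow_of_pos (one_div_pos.2 hpq.pos)]; simp
  have h1 : x ^ (1 / p) * x ^ (1 / q) = x := by
    rw [← ENNReal.rpow_add _ _ hx0 hx]
    have : 1 / p + 1 / q = 1 := by simpa using hpq.inv_add_inv_eq_one
    rw [this, ENNReal.rpow_one]
  rw [← ENNReal.mul_le_mul_iff_left (c := x ^ (1 / q)), h1]
  · exact h
  · exact (ENNReal.rpow_pos (pos_iff_ne_zero.2 hx0) hx).ne'
  · exact ENNReal.rpow_ne_top_of_nonneg (one_div_nonneg.2 hpq.symm.pos.le) hx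

theorem ConjPoissonBound.dual {p q C : ℝ≥0∞} (hp2 : 2 ≤ p) (hp' : p < ∞) (hq1 : 1 < q)
    (hq' : q < ∞) (hpq : p.toReal.HolderConjugate q.toReal) (h : ConjPoissonBound ℝ q C) :
    ConjPoissonBound ℝ p C := by
  intro y hy f hf hfc
  have hp0 : p ≠ 0 := by rintro rfl; simp at hp2
  have hq0 : q ≠ 0 := (zero_lt_one.trans hq1).ne'
  have hpr2 : 2 ≤ p.toReal := by
    have := ENNReal.toReal_mono hp'.ne hp2
    simpa using this
  set P := p.toReal
  set Q := q.toReal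
  have hP0 : 0 < P := hpq.pos
  have hQ0 : 0 < Q := hpq.symm.pos
  have hPQ : (P - 1) * Q = P := hpq.sub_one_mul_conj
  have hQ1 : 1 < Q := hpq.symm.lt
  set H := conjPoisson y f
  have hHc : Continuous H := continuous_conjPoisson hf hfc hy
  have key : ∀ N : ℕ, ∫⁻ x in Set.Ioc (-(N : ℝ)) N, ‖H x‖ₑ ^ P ≤ (C * eLpNorm f p volume) ^ P := by
    intro N
    set χ : ℝ → ℝ := fun x => max 0 (min 1 (N + 1 - |x|)) with hχ
    have hχc : Continuous χ := by fun_prop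
    have hχ0 : ∀ x, 0 ≤ χ x := fun x => le_max_left _ _
    have hχ1 : ∀ x, χ x ≤ 1 := fun x => max_le zero_le_one (min_le_left _ _)
    have hχs : HasCompactSupport χ := by
      refine HasCompactSupport.intro (isCompact_closedBall (0 : ℝ) (N + 1)) fun x hx => ?_
      simp only [Metric.mem_closedBall, dist_zero_right, Real.norm_eq_abs, not_le] at hx
      exact max_eq_left ((min_le_right _ _).trans (by linarith))
    have habs : Continuous fun x => |H x| ^ (P - 2) :=
      hHc.abs.rpow_const fun x => Or.inr (by linarith)
    set g : ℝ → ℝ := fun x => χ x * (H x * |H x| ^ (P - 2)) with hg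
    have hgc : Continuous g := hχc.mul (hHc.mul habs)
    have hgs : HasCompactSupport g := hχs.mul_right
    have hgH : ∀ x, g x * H x = χ x * |H x| ^ P := by
      intro x
      rcases eq_or_ne (H x) 0 with h0 | h0
      · simp [hg, h0, Real.zero_rpow hP0.ne']
      · have : |H x| ^ P = |H x| ^ (P - 2) * (H x) ^ 2 := by
          rw [← sq_abs (H x), ← Real.rpow_natCast, ← Real.rpow_add (abs_pos.2 h0)]
          congr 1; push_cast; ring
        rw [this]; simp only [hg]; ring
    have hgn : ∀ x, ‖g x‖ₑ ^ Q ≤ ENNReal.ofReal (χ x * |H x| ^ P) := by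
      intro x
      rw [← ofReal_norm, ENNReal.ofReal_rpow_of_nonneg (norm_nonneg _) hQ0.le]
      refine ENNReal.ofReal_le_ofReal ?_
      rcases eq_or_ne (H x) 0 with h0 | h0
      · simp [hg, h0, Real.zero_rpow hP0.ne', Real.zero_rpow hQ0.ne']
      have e : ‖g x‖ = χ x * |H x| ^ (P - 1) := by
        simp only [hg]
        rw [norm_mul, norm_mul, Real.norm_of_nonneg (hχ0 x), Real.norm_eq_abs,
          Real.norm_of_nonneg (by positivity)]
        congr 1
        nth_rw 1 [← Real.rpow_one |H x|]
        rw [← Real.rpow_add (abs_pos.2 h0)]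
        congr 1; ring
      rw [e, Real.mul_rpow (hχ0 x) (by positivity), ← Real.rpow_mul (abs_nonneg _), hPQ]
      gcongr
      rcases (hχ0 x).eq_or_lt with h1 | h1
      · rw [← h1, Real.zero_rpow hQ0.ne']
      · exact Real.rpow_le_self_of_le_one h1.le (hχ1 x) hQ1.le
    set I := ∫⁻ x, ENNReal.ofReal (χ x * |H x| ^ P) with hI
    have hint : Integrable fun x => g x * H x :=
      (hgc.mul hHc).integrable_of_hasCompactSupport hgs.mul_right
    have hIeq : I = ENNReal.ofReal (∫ x, g x * H x) := by
      rw [ofReal_integral_eq_lintegral_ofReal hint]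
      · simp only [hgH, hI]
      · refine Filter.Eventually.of_forall fun x => ?_
        simp only [hgH]
        have := hχ0 x
        positivity
    have hIle : I ≤ (C * eLpNorm f p volume) * I ^ (1 / Q) := by
      calc I = ENNReal.ofReal (- ∫ t, f t * conjPoisson y g t) := by
            rw [hIeq, integral_mul_conjPoisson hf hfc hgc hgs hy]
        _ ≤ ‖∫ t, f t * conjPoisson y g t‖ₑ := by
            rw [← ofReal_norm]
            exact ENNReal.ofReal_le_ofReal (neg_le_abs _)
        _ ≤ ∫⁻ t, ‖f t‖ₑ * ‖conjPoisson y g t‖ₑ := by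
            refine (enorm_integral_le_lintegral_enorm _).trans (le_of_eq ?_)
            simp only [enorm_mul]
        _ ≤ eLpNorm f p volume * eLpNorm (conjPoisson y g) q volume := by
            rw [eLpNorm_eq_lintegral_rpow_enorm_toReal hp0 hp'.ne,
              eLpNorm_eq_lintegral_rpow_enorm_toReal hq0 hq'.ne]
            exact ENNReal.lintegral_mul_le_Lp_mul_Lq _ hpq hf.measurable.enorm.aemeasurable
              (continuous_conjPoisson hgc hgs hy).measurable.enorm.aemeasurable
        _ ≤ eLpNorm f p volume * (C * I ^ (1 / Q)) := by
            gcongr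
            refine (h y hy g hgc hgs).trans ?_
            gcongr
            rw [eLpNorm_eq_lintegral_rpow_enorm_toReal hq0 hq'.ne]
            exact ENNReal.rpow_le_rpow (lintegral_mono hgn) (by positivity)
        _ = _ := by ring
    have hI' := ENNReal.rpow_le_rpow (ENNReal.rpow_one_div_le_of_le_mul_rpow hpq
      (by rw [hIeq]; simp) hIle) hP0.le
    rw [← ENNReal.rpow_mul, one_div_mul_cancel hP0.ne', ENNReal.rpow_one] at hI'
    refine le_trans ?_ hI'
    refine le_trans (setLIntegral_mono' measurableSet_Ioc fun x hx => ?_)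
      (setLIntegral_le_lintegral (Set.Ioc (-(N : ℝ)) N) _)
    have hx1 : χ x = 1 := by
      have : |x| ≤ N := abs_le.2 ⟨hx.1.le, hx.2⟩
      simp only [hχ]
      rw [min_eq_left (by linarith), max_eq_right zero_le_one]
    rw [hx1, one_mul, ← ENNReal.ofReal_rpow_of_nonneg (abs_nonneg _) hP0.le, ← Real.norm_eq_abs,
      ofReal_norm]
  have hlim : Filter.Tendsto (fun N : ℕ => ∫⁻ x in Set.Ioc (-(N : ℝ)) N, ‖H x‖ₑ ^ P)
      Filter.atTop (nhds (∫⁻ x : ℝ, ‖H x‖ₑ ^ P)) := by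
    refine AECover.lintegral_tendsto_of_countably_generated
      (aecover_Ioc (Filter.tendsto_neg_atTop_atBot.comp tendsto_natCast_atTop_atTop)
        tendsto_natCast_atTop_atTop) ?_
    exact (hHc.measurable.enorm.pow_const _).aemeasurable
  have := le_of_tendsto' hlim key
  rw [eLpNorm_eq_lintegral_rpow_enorm_toReal hp0 hp'.ne]
  refine (ENNReal.rpow_le_rpow this (by positivity)).trans ?_
  rw [← ENNReal.rpow_mul, mul_one_div_cancel hP0.ne', ENNReal.rpow_one]

theorem exists_conjPoissonBound_real {p : ℝ≥0∞} (hp : 1 < p) (hp' : p < ∞) :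
    ∃ C : ℝ≥0∞, C ≠ ∞ ∧ ConjPoissonBound ℝ p C := by
  rcases le_total p 2 with h2 | h2
  · exact exists_conjPoissonBound_of_le_two hp h2
  have hpr : 2 ≤ p.toReal := by
    have := ENNReal.toReal_mono hp'.ne h2
    simpa using this
  have hpq := Real.HolderConjugate.conjExponent (by linarith : 1 < p.toReal)
  set Q := p.toReal.conjExponent
  have hQ1 : 1 < Q := hpq.symm.lt
  have hQ2 : Q ≤ 2 := by
    simp only [Q, Real.conjExponent]
    rw [div_le_iff₀ (by linarith)]; linarith
  have hq1 : 1 < ENNReal.ofReal Q := by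
    rw [← ENNReal.ofReal_one]; exact (ENNReal.ofReal_lt_ofReal_iff (by linarith)).2 hQ1
  have hq2 : ENNReal.ofReal Q ≤ 2 := by
    rw [show (2 : ℝ≥0∞) = ENNReal.ofReal 2 by simp]; exact ENNReal.ofReal_le_ofReal hQ2
  obtain ⟨C, hC, h⟩ := exists_conjPoissonBound_of_le_two hq1 hq2
  refine ⟨C, hC, h.dual h2 hp' hq1 (by simp) ?_⟩
  rwa [ENNReal.toReal_ofReal (by linarith)]

theorem exists_conjPoissonBound (W : Type*) [NormedAddCommGroup W] [NormedSpace ℝ W]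
    [FiniteDimensional ℝ W] {p : ℝ≥0∞} (hp : 1 < p) (hp' : p < ∞) :
    ∃ C : ℝ≥0∞, C ≠ ∞ ∧ ConjPoissonBound W p C := by
  obtain ⟨C, hC, h⟩ := exists_conjPoissonBound_real hp hp'
  set b := Module.finBasis ℝ W
  set c : ∀ i, W →L[ℝ] ℝ := fun i => (b.coord i).toContinuousLinearMap
  refine ⟨∑ i, ‖b i‖ₑ * (C * ‖c i‖ₑ), ?_, fun y hy f hf hfc => ?_⟩
  · exact ENNReal.sum_ne_top.2 fun i _ =>
      ENNReal.mul_ne_top (by simp) (ENNReal.mul_ne_top hC (by simp))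
  have hci : ∀ i, Continuous fun t => c i (f t) := fun i => (c i).continuous.comp hf
  have hcs : ∀ i, HasCompactSupport fun t => c i (f t) := fun i =>
    hfc.comp_left (g := c i) (map_zero _)
  have e : conjPoisson y f = ∑ i, fun x => conjPoisson y (fun t => c i (f t)) x • b i := by
    ext x
    rw [Finset.sum_apply, ← b.sum_repr (conjPoisson y f x)]
    refine Finset.sum_congr rfl fun i _ => ?_
    congr 1
    change c i (conjPoisson y f x) = _
    simp only [conjPoisson]
    rw [← (c i).integral_comp_comm (integrable_conjPoisson hf hfc hy x)]
    simp
  rw [e, Finset.sum_mul]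
  refine (eLpNorm_sum_le (fun i _ => ?_) hp.le).trans (Finset.sum_le_sum fun i _ => ?_)
  · exact ((continuous_conjPoisson (hci i) (hcs i) hy).smul continuous_const).aestronglyMeasurable
  have e2 : eLpNorm (fun x => conjPoisson y (fun t => c i (f t)) x • b i) p volume ≤
      ‖b i‖ₑ * eLpNorm (conjPoisson y (fun t => c i (f t))) p volume := by
    exact eLpNorm_le_mul_eLpNorm_of_ae_le_mul'' p
      (continuous_conjPoisson (hci i) (hcs i) hy).aestronglyMeasurable
      (.of_forall fun x => by rw [enorm_smul, mul_comm])
  refine e2.trans ?_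
  rw [mul_assoc, mul_assoc]
  gcongr
  refine (h y hy _ (hci i) (hcs i)).trans ?_
  gcongr
  exact eLpNorm_le_mul_eLpNorm_of_ae_le_mul'' p hf.aestronglyMeasurable
    (.of_forall fun x => (c i).le_opENorm (f x))

/-- The kernel of the truncated Hilbert transform. -/
def truncInv (δ t : ℝ) : ℝ := Set.indicator {t : ℝ | δ < |t|} (fun t => t⁻¹) t

theorem measurable_truncInv : Measurable fun z : ℝ × ℝ => truncInv z.1 z.2 := by
  have : (fun z : ℝ × ℝ => truncInv z.1 z.2) =
      Set.indicator {z : ℝ × ℝ | z.1 < |z.2|} fun z => z.2⁻¹ := by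
    ext z; simp [truncInv, Set.indicator_apply]
  rw [this]
  exact (measurable_snd.inv).indicator (measurableSet_lt measurable_fst (by fun_prop))

theorem abs_truncInv_le {δ : ℝ} (hδ : 0 < δ) (t : ℝ) : |truncInv δ t| ≤ δ⁻¹ := by
  simp only [truncInv, Set.indicator_apply, Set.mem_ofPred_eq]
  split_ifs with h
  · rw [abs_inv]; gcongr
  · simp [hδ.le]

theorem abs_truncInv_sub_le {δ : ℝ} (hδ : 0 < δ) (t : ℝ) :
    |truncInv δ t - t / (t ^ 2 + δ ^ 2)| ≤ δ / (t ^ 2 + δ ^ 2) := by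
  simp only [truncInv, Set.indicator_apply, Set.mem_ofPred_eq]
  have hp : 0 < t ^ 2 + δ ^ 2 := by positivity
  split_ifs with h
  · have ht : t ≠ 0 := by rintro rfl; simp at h; linarith
    have : t⁻¹ - t / (t ^ 2 + δ ^ 2) = δ / (t ^ 2 + δ ^ 2) * (δ / t) := by field_simp; ring
    rw [this, abs_mul, abs_of_pos (by positivity), abs_div, abs_of_pos hδ]
    exact mul_le_of_le_one_right (by positivity) ((div_le_one (hδ.trans h)).2 h.le)
  · rw [zero_sub, abs_neg, abs_div, abs_of_pos hp]
    gcongr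
    exact not_lt.1 h

section
variable {W : Type*} [NormedAddCommGroup W] [NormedSpace ℝ W] {f : ℝ → W}

theorem integrable_truncInv_smul (hf : Continuous f) (hc : HasCompactSupport f) {δ : ℝ}
    (hδ : 0 < δ) : Integrable fun t : ℝ => truncInv δ t • f t :=
  (hf.integrable_of_hasCompactSupport hc).bdd_smul δ⁻¹
    (measurable_truncInv.comp measurable_prodMk_left).aestronglyMeasurable
    (.of_forall fun t => abs_truncInv_le hδ t)

/-- Uniform boundedness of the truncated Hilbert transforms. -/
theorem ConjPoissonBound.eLpNorm_truncInv_le {p C : ℝ≥0∞} (h : ConjPoissonBound W p C)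
    (hp : 1 < p) (hp' : p < ∞) {δ : ℝ} (hδ : 0 < δ) (hf : Continuous f)
    (hc : HasCompactSupport f) :
    eLpNorm (fun x => ∫ t, truncInv δ t • f (x - t)) p volume ≤
      (C + ENNReal.ofReal Real.pi) * eLpNorm f p volume := by
  have hi : ∀ x, Integrable fun t => truncInv δ t • f (x - t) := fun x =>
    integrable_truncInv_smul (by fun_prop) (hasCompactSupport_comp_const_sub hc x) hδ
  set F : ℝ → W := fun x => (∫ t, truncInv δ t • f (x - t)) - conjPoisson δ f x
  have hF : eLpNorm F p volume ≤ ENNReal.ofReal Real.pi * eLpNorm f p volume := by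
    refine eLpNorm_poisson_le hp hp' hδ hf fun x => ?_
    simp only [F, conjPoisson]
    rw [← integral_sub (hi x) (integrable_conjPoisson hf hc hδ x)]
    refine (enorm_integral_le_lintegral_enorm _).trans (lintegral_mono fun t => ?_)
    rw [← sub_smul, enorm_smul]
    gcongr
    rw [← ofReal_norm]
    exact ENNReal.ofReal_le_ofReal (abs_truncInv_sub_le hδ t)
  have e : (fun x => ∫ t, truncInv δ t • f (x - t)) = conjPoisson δ f + F := by
    ext x; simp [F]
  have hm : Continuous (conjPoisson δ f) := continuous_conjPoisson hf hc hδ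
  have hm2 : AEStronglyMeasurable (fun x => ∫ t, truncInv δ t • f (x - t)) volume := by
    refine (StronglyMeasurable.integral_prod_right ?_).aestronglyMeasurable
    exact (measurable_truncInv.comp (measurable_const.prodMk measurable_snd)).stronglyMeasurable.smul
      (hf.comp (by fun_prop : Continuous fun z : ℝ × ℝ => z.1 - z.2)).stronglyMeasurable
  rw [e, add_mul]
  exact (eLpNorm_add_le hm.aestronglyMeasurable (hm2.sub hm.aestronglyMeasurable) hp.le).trans
    (add_le_add (h δ hδ f hf hc) hF)
end

section
variable {E : Type*} [NormedAddCommGroup E] [NormedSpace ℝ E] [FiniteDimensional ℝ E]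
  [MeasurableSpace E] [BorelSpace E] (μ : Measure E) [μ.IsAddHaarMeasure]

theorem lintegral_eq_lintegral_lines {u : E} {l : E →L[ℝ] ℝ} (hl : l u = 1) {g : E → ℝ≥0∞}
    (hg : Measurable g) :
    ∫⁻ x, g x ∂μ = ∫⁻ x in l ⁻¹' Set.Ico 0 1, (∫⁻ s : ℝ, g (x + s • u)) ∂μ := by
  have hS : MeasurableSet (l ⁻¹' Set.Ico 0 1) := l.continuous.measurable measurableSet_Ico
  have hSm : Measurable ((l ⁻¹' Set.Ico (0 : ℝ) 1).indicator (1 : E → ℝ≥0∞)) :=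
    measurable_one.indicator hS
  symm
  calc ∫⁻ x in l ⁻¹' Set.Ico 0 1, (∫⁻ s : ℝ, g (x + s • u)) ∂μ
      = ∫⁻ x, (∫⁻ s : ℝ, (l ⁻¹' Set.Ico 0 1).indicator 1 x * g (x + s • u)) ∂μ := by
        rw [← lintegral_indicator hS]
        refine lintegral_congr fun x => ?_
        by_cases hx : x ∈ l ⁻¹' Set.Ico 0 1 <;> simp [Set.indicator, hx]
    _ = ∫⁻ s : ℝ, ∫⁻ x, (l ⁻¹' Set.Ico 0 1).indicator 1 x * g (x + s • u) ∂μ :=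
        lintegral_lintegral_swap (by fun_prop)
    _ = ∫⁻ s : ℝ, ∫⁻ x, (l ⁻¹' Set.Ico 0 1).indicator 1 (x - s • u) * g x ∂μ := by
        refine lintegral_congr fun s => ?_
        rw [← lintegral_sub_right_eq_self _ (s • u)]
        simp
    _ = ∫⁻ x, (∫⁻ s : ℝ, (l ⁻¹' Set.Ico 0 1).indicator 1 (x - s • u) * g x) ∂μ :=
        (lintegral_lintegral_swap (by fun_prop)).symm
    _ = ∫⁻ x, g x ∂μ := by
        refine lintegral_congr fun x => ?_
        rw [lintegral_mul_const _ (by fun_prop)]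
        have : (fun s : ℝ => (l ⁻¹' Set.Ico (0 : ℝ) 1).indicator (1 : E → ℝ≥0∞) (x - s • u)) =
            (Set.Ioc (l x - 1) (l x)).indicator 1 := by
          ext s
          simp only [Set.indicator, Set.mem_preimage, Set.mem_Ico, Set.mem_Ioc, map_sub, map_smul,
            hl, smul_eq_mul, mul_one]
          congr 1
          rw [eq_iff_iff]
          constructor <;> rintro ⟨h1, h2⟩ <;> constructor <;> linarith
        rw [this, lintegral_indicator_one measurableSet_Ioc]
        simp

variable {W : Type*} [NormedAddCommGroup W] [NormedSpace ℝ W] {f : E → W}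

/-- Uniform boundedness of the truncated directional Hilbert transforms. -/
theorem ConjPoissonBound.eLpNorm_directional_le {p C : ℝ≥0∞} (h : ConjPoissonBound W p C)
    (hC : C ≠ ∞) (hp : 1 < p) (hp' : p < ∞) {δ : ℝ} (hδ : 0 < δ) (hf : Continuous f)
    (hc : HasCompactSupport f) {u : E} (hu : u ≠ 0) :
    eLpNorm (fun x => ∫ t : ℝ, truncInv δ t • f (x - t • u)) p μ ≤
      (C + ENNReal.ofReal Real.pi) * eLpNorm f p μ := by
  have hp0 : p ≠ 0 := (zero_lt_one.trans hp).ne'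
  have hpr : 0 < p.toReal := ENNReal.toReal_pos hp0 hp'.ne
  obtain ⟨l, hl⟩ := SeparatingDual.exists_eq_one (R := ℝ) hu
  set F : E → W := fun x => ∫ t : ℝ, truncInv δ t • f (x - t • u)
  have hF : StronglyMeasurable F := by
    refine StronglyMeasurable.integral_prod_right ?_
    exact (measurable_truncInv.comp (measurable_const.prodMk measurable_snd)).stronglyMeasurable.smul
      (hf.comp (by fun_prop : Continuous fun z : E × ℝ => z.1 - z.2 • u)).stronglyMeasurable
  have lines : ∀ x, ∫⁻ s : ℝ, ‖F (x + s • u)‖ₑ ^ p.toReal ≤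
      (C + ENNReal.ofReal Real.pi) ^ p.toReal * ∫⁻ s : ℝ, ‖f (x + s • u)‖ₑ ^ p.toReal := by
    intro x
    have hfx : Continuous fun s : ℝ => f (x + s • u) := by fun_prop
    have hcx : HasCompactSupport fun s : ℝ => f (x + s • u) :=
      hc.comp_isClosedEmbedding ((Homeomorph.addLeft x).isClosedEmbedding.comp
        (isClosedEmbedding_smul_left hu))
    have := h.eLpNorm_truncInv_le hp hp' hδ hfx hcx
    rw [eLpNorm_eq_lintegral_rpow_enorm_toReal hp0 hp'.ne,
      eLpNorm_eq_lintegral_rpow_enorm_toReal hp0 hp'.ne] at this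
    have := ENNReal.rpow_le_rpow this hpr.le
    rw [ENNReal.mul_rpow_of_nonneg _ _ hpr.le, ← ENNReal.rpow_mul, ← ENNReal.rpow_mul,
      one_div_mul_cancel hpr.ne', ENNReal.rpow_one, ENNReal.rpow_one] at this
    refine le_trans (lintegral_mono fun s => le_of_eq ?_) this
    simp only [F]
    congr 3
    ext t
    rw [sub_smul, add_sub_assoc]
  rw [eLpNorm_eq_lintegral_rpow_enorm_toReal hp0 hp'.ne,
    eLpNorm_eq_lintegral_rpow_enorm_toReal hp0 hp'.ne,
    lintegral_eq_lintegral_lines μ hl (hF.enorm.pow_const _),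
    lintegral_eq_lintegral_lines μ hl (hf.stronglyMeasurable.enorm.pow_const _)]
  calc _ ≤ (∫⁻ x in l ⁻¹' Set.Ico 0 1, (C + ENNReal.ofReal Real.pi) ^ p.toReal *
      (∫⁻ s : ℝ, ‖f (x + s • u)‖ₑ ^ p.toReal) ∂μ) ^ (1 / p.toReal) := by
        refine ENNReal.rpow_le_rpow (lintegral_mono fun x => ?_) (by positivity)
        exact lines x
    _ = _ := ?_
  rw [lintegral_const_mul', ENNReal.mul_rpow_of_nonneg _ _ (by positivity), ← ENNReal.rpow_mul,
      mul_one_div_cancel hpr.ne', ENNReal.rpow_one]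
  exact ENNReal.rpow_ne_top_of_nonneg hpr.le (by simpa using hC)
end

theorem integral_indicator_inv_abs {r : ℝ} (hr : 0 < r) :
    ∫ t : ℝ, {t : ℝ | |t| ≤ r ∧ r < 2 * |t|}.indicator (fun t => |t|⁻¹) t = 2 * Real.log 2 := by
  have e : ∀ t : ℝ, {t : ℝ | |t| ≤ r ∧ r < 2 * |t|}.indicator (fun t => |t|⁻¹) t =
      (Set.Ioc (r / 2) r).indicator (fun t => t⁻¹) |t| := by
    intro t
    simp only [Set.indicator_apply, Set.mem_ofPred_eq, Set.mem_Ioc]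
    congr 1
    rw [eq_iff_iff]
    constructor <;> rintro ⟨h1, h2⟩ <;> constructor <;> linarith
  have hsub : Set.Ioi 0 ∩ Set.Ioc (r / 2) r = Set.Ioc (r / 2) r :=
    Set.inter_eq_right.2 fun t ht => (half_pos hr).trans ht.1
  simp_rw [e]
  rw [integral_comp_abs (f := (Set.Ioc (r / 2) r).indicator fun t => t⁻¹),
    setIntegral_indicator measurableSet_Ioc,
    hsub,
    ← intervalIntegral.integral_of_le (by linarith), integral_inv_of_pos (by linarith) hr]
  congr 2
  field_simp

theorem integrable_of_bound_of_support {X W : Type*} [MeasurableSpace X] [NormedAddCommGroup W]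
    {μ : Measure X} {F : X → W} (hF : AEStronglyMeasurable F μ) {s : Set X} (hs : μ s ≠ ∞)
    {M : ℝ} (hM : ∀ x, ‖F x‖ ≤ M) (h0 : ∀ x ∉ s, F x = 0) : Integrable F μ := by
  rw [← integrableOn_iff_integrable_of_support_subset (s := s)
    (fun x hx => by_contra fun h => hx (h0 x h))]
  exact Measure.integrableOn_of_bounded hs hF (.of_forall hM)

theorem MeasureTheory.StronglyMeasurable.clm_apply_comp {X W : Type*} [MeasurableSpace X]
    [NormedAddCommGroup W] [NormedSpace ℝ W]
    {L : X → W →L[ℝ] W} {g : X → W} (hL : StronglyMeasurable L) (hg : StronglyMeasurable g) :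
    StronglyMeasurable fun x => L x (g x) :=
  isBoundedBilinearMap_apply.continuous.comp_stronglyMeasurable (hL.prodMk hg)

theorem HasCompactSupport.exists_radius_sub {E W : Type*} [NormedAddCommGroup E]
    [NormedAddCommGroup W] {f : E → W} (hc : HasCompactSupport f) (x : E) :
    ∃ R : ℝ, 0 < R ∧ ∀ v, R < ‖v‖ → f (x - v) = 0 := by
  obtain ⟨R, hR⟩ := hc.isCompact.isBounded.exists_norm_le
  refine ⟨max (R + ‖x‖) 1, by positivity, fun v hv => by_contra fun h => ?_⟩
  have h1 := hR (x - v) (subset_tsupport _ h)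
  have h2 : ‖v‖ ≤ ‖x - v‖ + ‖x‖ := by
    calc ‖v‖ = ‖x - (x - v)‖ := by simp
      _ ≤ _ := by rw [add_comm]; exact norm_sub_le _ _
  have := le_max_left (R + ‖x‖) 1
  linarith

section
variable {E : Type*} [NormedAddCommGroup E] [NormedSpace ℝ E] [FiniteDimensional ℝ E]
  {W : Type*} [NormedAddCommGroup W] [NormedSpace ℝ W] [FiniteDimensional ℝ W]

/-- A kernel that is continuous off the origin and homogeneous of degree `-dim E`
under all nonzero real dilations. -/
structure IsHomogeneousKernel (K : E → W →L[ℝ] W) : Prop where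
  continuousOn : ContinuousOn K {0}ᶜ
  map_smul : ∀ (t : ℝ) (u : E), t ≠ 0 → K (t • u) = (t ^ Module.finrank ℝ E)⁻¹ • K u

/-- Truncated convolution with an operator valued kernel. -/
def truncConv [MeasurableSpace E] (μ : Measure E) (K : E → W →L[ℝ] W) (ε : ℝ) (f : E → W) (x : E) :
    W := ∫ u, {u : E | ε < ‖u‖}.indicator (fun u => K u (f (x - u))) u ∂μ

namespace IsHomogeneousKernel
variable {K : E → W →L[ℝ] W} (hK : IsHomogeneousKernel K)
include hK

theorem exists_norm_le : ∃ M : ℝ, 0 ≤ M ∧ ∀ u, u ≠ 0 → ‖K u‖ ≤ M * (‖u‖ ^ Module.finrank ℝ E)⁻¹ := by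
  obtain ⟨M, hM⟩ := (isCompact_sphere (0 : E) 1).exists_bound_of_continuousOn
    (hK.continuousOn.mono fun u hu => by
      rintro (rfl : u = 0)
      simp at hu)
  refine ⟨|M|, abs_nonneg _, fun u hu => ?_⟩
  have hu' : ‖u‖ ≠ 0 := norm_ne_zero_iff.2 hu
  have : K u = (‖u‖ ^ Module.finrank ℝ E)⁻¹ • K (‖u‖⁻¹ • u) := by
    rw [← hK.map_smul _ _ hu', smul_smul, mul_inv_cancel₀ hu', one_smul]
  rw [this, norm_smul, mul_comm]
  gcongr
  · exact (hM _ (by simp [norm_smul, hu'])).trans (le_abs_self _)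
  · rw [norm_inv, norm_pow, norm_norm]

theorem stronglyMeasurable [MeasurableSpace E] [BorelSpace E] : StronglyMeasurable K := by
  borelize (W →L[ℝ] W)
  exact (measurable_of_continuousOn_compl_singleton 0 hK.continuousOn).stronglyMeasurable

variable [MeasurableSpace E] [BorelSpace E] (μ : Measure E) [μ.IsAddHaarMeasure] {f : E → W}

/-- Bound for the kernel away from the origin. -/
theorem exists_norm_le_of_lt {ε : ℝ} (hε : 0 < ε) : ∃ M : ℝ, 0 ≤ M ∧ ∀ u, ε ≤ ‖u‖ → ‖K u‖ ≤ M := by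
  obtain ⟨M, hM0, hM⟩ := hK.exists_norm_le
  refine ⟨M * (ε ^ Module.finrank ℝ E)⁻¹, by positivity, fun u hu => (hM u ?_).trans (by gcongr)⟩
  rintro rfl
  simp at hu; linarith

/-- The method of rotations: the truncated singular integral is an average of truncated
directional Hilbert transforms. -/
theorem truncConv_eq_integral (hm : Odd (Module.finrank ℝ E)) (hf : Continuous f)
    (hc : HasCompactSupport f) {ε : ℝ} (hε : 0 < ε) (x : E) :
    (2 * Real.log 2) • truncConv μ K ε f x =
      ∫ u in {u : E | 1 ≤ ‖u‖ ∧ ‖u‖ < 2},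
        K u (∫ t : ℝ, truncInv (ε / ‖u‖) t • f (x - t • u)) ∂μ := by
  set m := Module.finrank ℝ E with hmdef
  set A : Set E := {u : E | 1 ≤ ‖u‖ ∧ ‖u‖ < 2} with hA
  have hAm : MeasurableSet A :=
    (measurableSet_le measurable_const measurable_norm).inter
      (measurableSet_lt measurable_norm measurable_const)
  obtain ⟨R, hR0, hR⟩ := hc.exists_radius_sub x
  obtain ⟨Mf, hMf⟩ := hc.exists_bound_of_continuous hf
  have hMf0 : 0 ≤ Mf := (norm_nonneg _).trans (hMf 0)
  obtain ⟨M₁, hM₁0, hM₁⟩ := hK.exists_norm_le_of_lt one_pos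
  obtain ⟨M₂, hM₂0, hM₂⟩ := hK.exists_norm_le_of_lt hε
  set Φ : E → ℝ → W := fun u t =>
    A.indicator (fun u => truncInv (ε / ‖u‖) t • K u (f (x - t • u))) u with hΦ
  set Ψ : E → ℝ → W := fun v t => {t : ℝ | |t| ≤ ‖v‖ ∧ ‖v‖ < 2 * |t|}.indicator (fun t => |t|⁻¹) t •
    {u : E | ε < ‖u‖}.indicator (fun u => K u (f (x - u))) v with hΨ
  have hKm : StronglyMeasurable K := hK.stronglyMeasurable
  have hfm : StronglyMeasurable f := hf.stronglyMeasurable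
  have hΦi : Integrable (Function.uncurry Φ) (μ.prod volume) := by
    refine integrable_of_bound_of_support (s := Metric.closedBall 0 2 ×ˢ Metric.closedBall 0 R)
      (M := 2 / ε * (M₁ * Mf)) ?_ ?_ ?_ ?_
    · have : Function.uncurry Φ = (Prod.fst ⁻¹' A).indicator fun z : E × ℝ =>
          truncInv (ε / ‖z.1‖) z.2 • K z.1 (f (x - z.2 • z.1)) := by
        ext z; rfl
      rw [this]
      refine (StronglyMeasurable.indicator ?_ (measurable_fst hAm)).aestronglyMeasurable
      have h1 : Measurable fun z : E × ℝ => truncInv (ε / ‖z.1‖) z.2 :=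
        measurable_truncInv.comp ((by fun_prop : Measurable fun z : E × ℝ => ε / ‖z.1‖).prodMk
          measurable_snd)
      exact h1.stronglyMeasurable.smul ((hKm.comp_measurable measurable_fst).clm_apply_comp
        (hfm.comp_measurable (by fun_prop)))
    · rw [Measure.prod_prod]
      exact ENNReal.mul_ne_top measure_closedBall_lt_top.ne measure_closedBall_lt_top.ne
    · rintro ⟨u, t⟩
      simp only [Function.uncurry, Φ, Set.indicator_apply]
      split_ifs with hu
      · have hu0 : 0 < ‖u‖ := one_pos.trans_le hu.1
        rw [norm_smul]
        refine mul_le_mul ((abs_truncInv_le (div_pos hε hu0) t).trans ?_)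
          ((K u).le_of_opNorm_le_of_le (hM₁ u hu.1) (hMf _)) (norm_nonneg _) (by positivity)
        rw [inv_div]
        gcongr
        exact hu.2.le
      · simp; positivity
    · rintro ⟨u, t⟩ h
      simp only [Function.uncurry, Φ, Set.indicator_apply]
      split_ifs with hu
      · rw [hR, map_zero, smul_zero]
        have h2 : R < |t| := by
          by_contra! h2
          exact h ⟨by simpa using hu.2.le, by simpa using h2⟩
        rw [norm_smul]
        exact h2.trans_le (le_mul_of_one_le_right (abs_nonneg _) hu.1)
      · rfl
  have hΨi : Integrable (Function.uncurry Ψ) (μ.prod volume) := by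
    refine integrable_of_bound_of_support (s := Metric.closedBall 0 R ×ˢ Metric.closedBall 0 R)
      (M := 2 / ε * (M₂ * Mf)) ?_ ?_ ?_ ?_
    · have : Function.uncurry Ψ = fun z : E × ℝ =>
          ({z : E × ℝ | |z.2| ≤ ‖z.1‖ ∧ ‖z.1‖ < 2 * |z.2|}.indicator fun z => |z.2|⁻¹) z •
            ({z : E × ℝ | ε < ‖z.1‖}.indicator fun z => K z.1 (f (x - z.1))) z := by
        ext z; simp [Ψ, Function.uncurry, Set.indicator_apply]
      rw [this]
      refine (StronglyMeasurable.smul ?_ ?_).aestronglyMeasurable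
      · refine (Measurable.indicator (by fun_prop) ?_).stronglyMeasurable
        exact (measurableSet_le (f := fun z : E × ℝ => |z.2|) (g := fun z => ‖z.1‖) (by fun_prop)
          (by fun_prop)).inter (measurableSet_lt (f := fun z : E × ℝ => ‖z.1‖)
            (g := fun z => 2 * |z.2|) (by fun_prop) (by fun_prop))
      · refine StronglyMeasurable.indicator ?_ (measurableSet_lt (by fun_prop) (by fun_prop))
        exact (hKm.comp_measurable measurable_fst).clm_apply_comp
          (hfm.comp_measurable (by fun_prop))
    · rw [Measure.prod_prod]
      exact ENNReal.mul_ne_top measure_closedBall_lt_top.ne measure_closedBall_lt_top.ne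
    · rintro ⟨v, t⟩
      simp only [Function.uncurry, Ψ, Set.indicator_apply, Set.mem_ofPred_eq]
      split_ifs with h1 h2 h2
      · rw [norm_smul]
        refine mul_le_mul ?_ ((K v).le_of_opNorm_le_of_le (hM₂ v h2.le) (hMf _)) (norm_nonneg _)
          (by positivity)
        rw [norm_inv, Real.norm_eq_abs, abs_abs, ← inv_div]
        gcongr
        linarith
      all_goals simp; positivity
    · rintro ⟨v, t⟩ h
      simp only [Function.uncurry, Ψ, Set.indicator_apply, Set.mem_ofPred_eq]
      split_ifs with h1 h2 h2
      · rw [hR, map_zero, smul_zero]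
        by_contra! h3
        exact h ⟨by simpa using h3, by simpa using h1.1.trans h3⟩
      all_goals simp
  have hscale : ∀ t : ℝ, t ≠ 0 → ∫ u, Φ u t ∂μ = ∫ v, Ψ v t ∂μ := by
    intro t ht
    have ht' : 0 < |t| := abs_pos.2 ht
    have e : ∀ u, Φ u t = (|t| ^ m) • Ψ (t • u) t := by
      intro u
      have hA' : u ∈ A ↔ |t| ≤ ‖t • u‖ ∧ ‖t • u‖ < 2 * |t| := by
        rw [norm_smul, Real.norm_eq_abs, mul_comm 2, mul_lt_mul_iff_right₀ ht',
          le_mul_iff_one_le_right ht']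
        rfl
      by_cases hu : u ∈ A
      · have hu0 : 0 < ‖u‖ := one_pos.trans_le hu.1
        simp only [Φ, Ψ, Set.indicator_of_mem hu, truncInv]
        rw [Set.indicator_of_mem (s := {s : ℝ | |s| ≤ ‖t • u‖ ∧ ‖t • u‖ < 2 * |s|}) (hA'.1 hu)]
        have h3 : t ∈ {t : ℝ | ε / ‖u‖ < |t|} ↔ t • u ∈ {u : E | ε < ‖u‖} := by
          simp only [Set.mem_ofPred_eq, norm_smul, Real.norm_eq_abs, div_lt_iff₀ hu0]
        by_cases h4 : t • u ∈ {u : E | ε < ‖u‖}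
        · rw [Set.indicator_of_mem (h3.2 h4), Set.indicator_of_mem h4, hK.map_smul t u ht,
            smul_apply, smul_smul, smul_smul]
          congr 1
          obtain ⟨k, hk⟩ := hm
          rw [← hmdef, hk]
          have h5 : |t| ^ (2 * k + 1) = t ^ (2 * k) * |t| := by
            rw [pow_succ, pow_mul, sq_abs, ← pow_mul]
          rw [h5]
          field_simp
          ring
        · rw [Set.indicator_of_notMem (mt h3.1 h4), Set.indicator_of_notMem h4]
          simp
      · simp only [Φ, Ψ, Set.indicator_of_notMem hu]
        rw [Set.indicator_of_notMem (s := {s : ℝ | |s| ≤ ‖t • u‖ ∧ ‖t • u‖ < 2 * |s|})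
          (mt hA'.2 hu)]
        simp
    simp_rw [e]
    rw [integral_smul, Measure.integral_comp_smul μ (fun v => Ψ v t), smul_smul, ← hmdef, abs_inv, abs_pow,
      mul_inv_cancel₀ (by positivity), one_smul]
  calc (2 * Real.log 2) • truncConv μ K ε f x = ∫ v, ∫ t, Ψ v t ∂volume ∂μ := by
        rw [truncConv, ← integral_smul]
        refine integral_congr_ae (.of_forall fun v => ?_)
        simp only [hΨ]
        rw [integral_smul_const]
        by_cases hv : ε < ‖v‖
        · rw [integral_indicator_inv_abs (hε.trans hv)]
        · rw [Set.indicator_of_notMem (by simpa using hv), smul_zero, smul_zero]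
    _ = ∫ t, ∫ v, Ψ v t ∂μ := integral_integral_swap hΨi
    _ = ∫ t, ∫ u, Φ u t ∂μ := by
        refine integral_congr_ae ?_
        filter_upwards [compl_mem_ae_iff.2 (measure_singleton (0 : ℝ))] with t ht
        exact (hscale t ht).symm
    _ = ∫ u, ∫ t, Φ u t ∂volume ∂μ := (integral_integral_swap hΦi).symm
    _ = _ := by
        rw [← integral_indicator hAm]
        refine integral_congr_ae (.of_forall fun u => ?_)
        by_cases hu : u ∈ A
        · simp only [hΦ, Set.indicator_of_mem hu]
          have hu0 : u ≠ 0 := by rintro rfl; simp [hA] at hu; linarith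
          have hcx : HasCompactSupport fun t : ℝ => f (x - t • u) :=
            hc.comp_isClosedEmbedding ((Homeomorph.subLeft x).isClosedEmbedding.comp
              (isClosedEmbedding_smul_left hu0))
          rw [← (K u).integral_comp_comm (integrable_truncInv_smul (by fun_prop) hcx
            (div_pos hε (norm_pos_iff.2 hu0)))]
          simp
        · simp [hΦ, Set.indicator_of_notMem hu]

end IsHomogeneousKernel
end

theorem integral_truncInv_sub {a b : ℝ} : ∫ t, (truncInv a t - truncInv b t) = 0 := by
  have h : ∀ a t, truncInv a (-t) = - truncInv a t := fun a t => by
    simp only [truncInv, Set.indicator_apply, Set.mem_ofPred_eq, abs_neg, inv_neg]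
    split_ifs <;> simp
  have := integral_neg_eq_self (fun t => truncInv a t - truncInv b t) volume
  simp only [h] at this
  have e : ∫ t, (-truncInv a t - -truncInv b t) = -∫ t, (truncInv a t - truncInv b t) := by
    rw [← integral_neg]
    congr 1; ext t; ring
  rw [e] at this
  linarith

section
variable {E : Type*} [NormedAddCommGroup E] [NormedSpace ℝ E] [FiniteDimensional ℝ E]
  {W : Type*} [NormedAddCommGroup W] [NormedSpace ℝ W] [FiniteDimensional ℝ W]

theorem norm_integral_truncInv_sub_le {f : E → W} (hf : Continuous f) (hc : HasCompactSupport f)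
    {L : ℝ} (hL : ∀ x y, ‖f x - f y‖ ≤ L * ‖x - y‖) {a b r : ℝ} (ha : 0 < a) (hb : 0 < b)
    (har : a ≤ r) (hbr : b ≤ r) {u : E} (hu : u ≠ 0) (x : E) :
    ‖(∫ t : ℝ, truncInv a t • f (x - t • u)) - ∫ t : ℝ, truncInv b t • f (x - t • u)‖ ≤
      L * ‖u‖ * (2 * r) := by
  have hcx : HasCompactSupport fun t : ℝ => f (x - t • u) :=
    hc.comp_isClosedEmbedding ((Homeomorph.subLeft x).isClosedEmbedding.comp
      (isClosedEmbedding_smul_left hu))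
  have hfx : Continuous fun t : ℝ => f (x - t • u) := by fun_prop
  have hd0 : ∀ t, t ∉ Metric.closedBall (0 : ℝ) r → truncInv a t - truncInv b t = 0 := by
    intro t ht
    have : r < |t| := by simpa using ht
    simp [truncInv, har.trans_lt this, hbr.trans_lt this]
  have hdi : Integrable fun t => truncInv a t - truncInv b t := by
    refine integrable_of_bound_of_support (s := Metric.closedBall 0 r) (M := a⁻¹ + b⁻¹) ?_
      measure_closedBall_lt_top.ne (fun t => ?_) hd0
    · exact ((measurable_truncInv.comp measurable_prodMk_left).sub
        (measurable_truncInv.comp measurable_prodMk_left)).aestronglyMeasurable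
    · exact (norm_sub_le _ _).trans (add_le_add (abs_truncInv_le ha t) (abs_truncInv_le hb t))
  have e : (∫ t : ℝ, truncInv a t • f (x - t • u)) - ∫ t : ℝ, truncInv b t • f (x - t • u) =
      ∫ t in Metric.closedBall (0 : ℝ) r,
        (truncInv a t - truncInv b t) • (f (x - t • u) - f x) := by
    rw [← integral_sub (integrable_truncInv_smul hfx hcx ha) (integrable_truncInv_smul hfx hcx hb),
      setIntegral_eq_integral_of_forall_compl_eq_zero fun t ht => by rw [hd0 t ht, zero_smul]]
    have h0 : ∫ t, (truncInv a t - truncInv b t) • f x = 0 := by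
      rw [integral_smul_const, integral_truncInv_sub, zero_smul]
    rw [← sub_zero (∫ t, _), ← h0, ← integral_sub _ (hdi.smul_const _)]
    · simp only [sub_smul, smul_sub]
    · exact (integrable_truncInv_smul hfx hcx ha).sub (integrable_truncInv_smul hfx hcx hb)
  rw [e]
  have hL0 : 0 ≤ L * ‖u‖ := by
    have := hL u 0
    rw [sub_zero] at this
    exact (norm_nonneg _).trans this
  refine (norm_setIntegral_le_of_norm_le_const (C := L * ‖u‖) measure_closedBall_lt_top
    fun t _ => ?_).trans_eq ?_
  · have h1 : |truncInv a t - truncInv b t| ≤ |t|⁻¹ := by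
      simp only [truncInv, Set.indicator_apply]
      split_ifs <;> simp
    by_cases ht : t = 0
    · simpa [ht] using hL0
    rw [norm_smul]
    calc _ ≤ |t|⁻¹ * (L * ‖x - t • u - x‖) := by
          gcongr
          · exact h1
          · exact hL _ _
      _ = L * ‖u‖ := by
          rw [sub_sub_cancel_left, norm_neg, norm_smul, Real.norm_eq_abs]
          have : |t| ≠ 0 := abs_ne_zero.2 ht
          field_simp
  · simp [Measure.real, Real.volume_closedBall, (ha.le.trans har)]

namespace IsHomogeneousKernel
variable {K : E → W →L[ℝ] W} (hK : IsHomogeneousKernel K)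
  [MeasurableSpace E] [BorelSpace E] (μ : Measure E) [μ.IsAddHaarMeasure]
include hK

theorem stronglyMeasurable_truncConv {f : E → W} (hf : StronglyMeasurable f) (ε : ℝ) :
    StronglyMeasurable (truncConv μ K ε f) := by
  refine StronglyMeasurable.integral_prod_right ?_
  exact StronglyMeasurable.indicator (s := {z : E × E | ε < ‖z.2‖})
    ((hK.stronglyMeasurable.comp_measurable measurable_snd).clm_apply_comp
      (hf.comp_measurable (by fun_prop))) (measurableSet_lt (by fun_prop) (by fun_prop))

theorem lintegral_enorm_annulus_ne_top :
    ∫⁻ u in {u : E | 1 ≤ ‖u‖ ∧ ‖u‖ < 2}, ‖K u‖ₑ ∂μ ≠ ∞ := by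
  obtain ⟨M, hM0, hM⟩ := hK.exists_norm_le_of_lt one_pos
  have hA : MeasurableSet {u : E | 1 ≤ ‖u‖ ∧ ‖u‖ < 2} :=
    (measurableSet_le measurable_const measurable_norm).inter
      (measurableSet_lt measurable_norm measurable_const)
  refine ne_top_of_le_ne_top ?_ (setLIntegral_mono' hA (g := fun _ => ENNReal.ofReal M)
    fun u hu => ?_)
  · rw [setLIntegral_const]
    refine ENNReal.mul_ne_top (by simp) (ne_top_of_le_ne_top
      (measure_closedBall_lt_top (x := (0 : E)) (r := 2)).ne (measure_mono fun u hu => ?_))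
    simpa using hu.2.le
  · rw [← ofReal_norm]
    exact ENNReal.ofReal_le_ofReal (hM u hu.1)

theorem exists_eLpNorm_truncConv_le (hm : Odd (Module.finrank ℝ E)) {p : ℝ≥0∞} (hp : 1 < p)
    (hp' : p < ∞) : ∃ C : ℝ≥0∞, C ≠ ∞ ∧ ∀ ε : ℝ, 0 < ε → ∀ f : E → W, Continuous f →
      HasCompactSupport f → eLpNorm (truncConv μ K ε f) p μ ≤ C * eLpNorm f p μ := by
  obtain ⟨C, hC, hb⟩ := exists_conjPoissonBound W hp hp'
  set A : Set E := {u : E | 1 ≤ ‖u‖ ∧ ‖u‖ < 2} with hA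
  have hAm : MeasurableSet A :=
    (measurableSet_le measurable_const measurable_norm).inter
      (measurableSet_lt measurable_norm measurable_const)
  refine ⟨‖(2 * Real.log 2)⁻¹‖ₑ * ((∫⁻ u in A, ‖K u‖ₑ ∂μ) * (C + ENNReal.ofReal Real.pi)),
    ENNReal.mul_ne_top enorm_ne_top (ENNReal.mul_ne_top (hK.lintegral_enorm_annulus_ne_top μ)
      (by simpa using hC)), fun ε hε f hf hc => ?_⟩
  have hlog : 2 * Real.log 2 ≠ 0 := by have := Real.log_pos one_lt_two; positivity
  have e : truncConv μ K ε f = (2 * Real.log 2)⁻¹ • fun x => ∫ u in A,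
        K u (∫ t : ℝ, truncInv (ε / ‖u‖) t • f (x - t • u)) ∂μ := by
    ext x
    rw [Pi.smul_apply, ← hK.truncConv_eq_integral μ hm hf hc hε x, smul_smul,
      inv_mul_cancel₀ hlog, one_smul]
  rw [e, eLpNorm_const_smul, mul_assoc, mul_assoc]
  gcongr
  refine eLpNorm_le_lintegral_mul_of_enorm_le hp hp' (k := fun u => ‖K u‖ₑ)
    (h := fun x u => ∫ t : ℝ, truncInv (ε / ‖u‖) t • f (x - t • u))
    hK.stronglyMeasurable.enorm ?_ (fun x => ?_) ?_
  · refine StronglyMeasurable.integral_prod_right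
      (f := fun (z : E × E) (t : ℝ) => truncInv (ε / ‖z.2‖) t • f (z.1 - t • z.2)) ?_
    have h1 : Measurable fun z : (E × E) × ℝ => truncInv (ε / ‖z.1.2‖) z.2 :=
      measurable_truncInv.comp
        ((by fun_prop : Measurable fun z : (E × E) × ℝ => ε / ‖z.1.2‖).prodMk measurable_snd)
    exact h1.stronglyMeasurable.smul (hf.comp
      (by fun_prop : Continuous fun z : (E × E) × ℝ => z.1.1 - z.2 • z.1.2)).stronglyMeasurable
  · refine (enorm_integral_le_lintegral_enorm _).trans (lintegral_mono fun u => ?_)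
    exact (K u).le_opENorm _
  · refine (ae_restrict_iff' hAm).2 (.of_forall fun u hu => ?_)
    have hu0 : u ≠ 0 := by rintro rfl; simp [hA] at hu; linarith
    exact hb.eLpNorm_directional_le μ hC hp hp' (div_pos hε (norm_pos_iff.2 hu0)) hf hc hu0

end IsHomogeneousKernel
end

section
variable {E : Type*} [NormedAddCommGroup E] [NormedSpace ℝ E] [FiniteDimensional ℝ E]
  {W : Type*} [NormedAddCommGroup W] [NormedSpace ℝ W] [FiniteDimensional ℝ W]
namespace IsHomogeneousKernel
variable {K : E → W →L[ℝ] W} (hK : IsHomogeneousKernel K)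
  [MeasurableSpace E] [BorelSpace E] (μ : Measure E) [μ.IsAddHaarMeasure]
include hK

theorem exists_eLpNorm_truncConv_sub_le (hm : Odd (Module.finrank ℝ E)) {f : E → W}
    (hf : Continuous f) (hc : HasCompactSupport f) {L : ℝ}
    (hL : ∀ x y, ‖f x - f y‖ ≤ L * ‖x - y‖) (p : ℝ≥0∞) :
    ∃ D : ℝ≥0∞, D ≠ ∞ ∧ ∀ r, r ≤ 1 → ∀ ε δ : ℝ, 0 < ε → 0 < δ → ε ≤ r → δ ≤ r →
      eLpNorm (truncConv μ K ε f - truncConv μ K δ f) p μ ≤ ENNReal.ofReal r * D := by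
  set A : Set E := {u : E | 1 ≤ ‖u‖ ∧ ‖u‖ < 2} with hA
  have hAm : MeasurableSet A :=
    (measurableSet_le measurable_const measurable_norm).inter
      (measurableSet_lt measurable_norm measurable_const)
  have hAfin : μ A < ∞ := (measure_mono (t := Metric.closedBall (0 : E) 2)
    (fun u hu => by simpa using hu.2.le)).trans_lt measure_closedBall_lt_top
  obtain ⟨M, hM0, hM⟩ := hK.exists_norm_le_of_lt one_pos
  obtain ⟨R, hR⟩ := hc.isCompact.isBounded.exists_norm_le
  have hlog : 0 < 2 * Real.log 2 := by have := Real.log_pos one_lt_two; positivity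
  have hLn : ∀ v : E, 0 ≤ L * ‖v‖ := fun v => by
    have := hL v 0
    rw [sub_zero] at this
    exact (norm_nonneg _).trans this
  set c : ℝ := (2 * Real.log 2)⁻¹ * (M * (4 * |L|) * μ.real A)
  have hc0 : 0 ≤ c := by positivity
  refine ⟨ENNReal.ofReal c * μ (Metric.closedBall 0 (R + 1)) ^ (1 / p.toReal),
    ENNReal.mul_ne_top (by simp) (ENNReal.rpow_ne_top_of_nonneg (by positivity)
      measure_closedBall_lt_top.ne), fun r hr1 ε δ hε hδ hεr hδr => ?_⟩
  have hr0 : 0 ≤ r := hε.le.trans hεr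
  have hint : ∀ ε : ℝ, 0 < ε → ∀ x, IntegrableOn
      (fun u => K u (∫ t : ℝ, truncInv (ε / ‖u‖) t • f (x - t • u))) A μ := by
    intro ε hε x
    obtain ⟨R', hR0', hR'⟩ := hc.exists_radius_sub x
    obtain ⟨Mf, hMf⟩ := hc.exists_bound_of_continuous hf
    refine Measure.integrableOn_of_bounded (M := M * ((ε / 2)⁻¹ * Mf * (2 * R'))) hAfin.ne ?_ ?_
    · refine (hK.stronglyMeasurable.clm_apply_comp ?_).aestronglyMeasurable
      refine StronglyMeasurable.integral_prod_right
        (f := fun (u : E) (t : ℝ) => truncInv (ε / ‖u‖) t • f (x - t • u)) ?_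
      have h1 : Measurable fun z : E × ℝ => truncInv (ε / ‖z.1‖) z.2 :=
        measurable_truncInv.comp
          ((by fun_prop : Measurable fun z : E × ℝ => ε / ‖z.1‖).prodMk measurable_snd)
      exact h1.stronglyMeasurable.smul (hf.comp
        (by fun_prop : Continuous fun z : E × ℝ => x - z.2 • z.1)).stronglyMeasurable
    · refine (ae_restrict_iff' hAm).2 (.of_forall fun u hu => ?_)
      have hun : 0 < ‖u‖ := one_pos.trans_le hu.1
      refine (K u).le_of_opNorm_le_of_le (hM u hu.1) ?_
      rw [← setIntegral_eq_integral_of_forall_compl_eq_zero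
        (s := Metric.closedBall (0 : ℝ) R') fun t ht => ?_]
      · refine (norm_setIntegral_le_of_norm_le_const (C := (ε / 2)⁻¹ * Mf)
          measure_closedBall_lt_top fun t _ => ?_).trans_eq ?_
        · rw [norm_smul]
          refine mul_le_mul ((abs_truncInv_le (div_pos hε hun) t).trans ?_) (hMf _)
            (norm_nonneg _) (by positivity)
          have := hu.2.le
          gcongr
        · simp [Measure.real, Real.volume_closedBall, hR0'.le]
      · have ht' : R' < |t| := by simpa using ht
        rw [hR', smul_zero]
        rw [norm_smul]
        exact ht'.trans_le (le_mul_of_one_le_right (abs_nonneg _) hu.1)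
  have hpt : ∀ x, ‖truncConv μ K ε f x - truncConv μ K δ f x‖ ≤ r * c := by
    intro x
    have e : truncConv μ K ε f x - truncConv μ K δ f x = (2 * Real.log 2)⁻¹ • ∫ u in A,
        K u ((∫ t : ℝ, truncInv (ε / ‖u‖) t • f (x - t • u)) -
          ∫ t : ℝ, truncInv (δ / ‖u‖) t • f (x - t • u)) ∂μ := by
      simp only [map_sub]
      rw [integral_sub (hint ε hε x) (hint δ hδ x), ← hK.truncConv_eq_integral μ hm hf hc hε x,
        ← hK.truncConv_eq_integral μ hm hf hc hδ x, ← smul_sub, smul_smul,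
        inv_mul_cancel₀ hlog.ne', one_smul]
    rw [e, norm_smul, Real.norm_of_nonneg (inv_nonneg.2 hlog.le)]
    have : r * c = (2 * Real.log 2)⁻¹ * (M * (4 * |L| * r) * μ.real A) := by ring
    rw [this]
    gcongr
    refine norm_setIntegral_le_of_norm_le_const hAfin fun u hu => ?_
    have hu0 : u ≠ 0 := by rintro rfl; simp [hA] at hu; linarith
    have hun := norm_pos_iff.2 hu0
    refine (K u).le_of_opNorm_le_of_le (hM u hu.1)
      ((norm_integral_truncInv_sub_le hf hc hL (div_pos hε hun) (div_pos hδ hun)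
        (r := r) ((div_le_self hε.le hu.1).trans hεr) ((div_le_self hδ.le hu.1).trans hδr)
        hu0 x).trans ?_)
    calc L * ‖u‖ * (2 * r) ≤ |L| * 2 * (2 * r) := by
          gcongr
          · exact le_abs_self L
          · exact hu.2.le
      _ = _ := by ring
  have hsupp : ∀ x, x ∉ Metric.closedBall (0 : E) (R + 1) →
      truncConv μ K ε f x - truncConv μ K δ f x = 0 := by
    intro x hx
    have hx' : R + 1 < ‖x‖ := by simpa using hx
    rw [sub_eq_zero]
    refine integral_congr_ae (.of_forall fun u => ?_)
    by_cases hu : 1 < ‖u‖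
    · rw [Set.indicator_of_mem, Set.indicator_of_mem]
      · exact (hδr.trans hr1).trans_lt hu
      · exact (hεr.trans hr1).trans_lt hu
    · have : f (x - u) = 0 := by
        by_contra h
        have h1 := hR _ (subset_tsupport _ h)
        have h2 := norm_sub_norm_le x u
        linarith
      simp [Set.indicator_apply, this]
  calc _ ≤ eLpNorm ((Metric.closedBall (0 : E) (R + 1)).indicator fun _ => r * c) p μ := by
        refine eLpNorm_mono fun x => ?_
        by_cases hx : x ∈ Metric.closedBall (0 : E) (R + 1)
        · rw [Set.indicator_of_mem hx]
          exact (hpt x).trans (le_abs_self _)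
        · rw [Set.indicator_of_notMem hx, Pi.sub_apply, hsupp x hx]
          simp
    _ ≤ _ := by
        refine (eLpNorm_indicator_const_le _ _).trans_eq ?_
        rw [← ofReal_norm, Real.norm_of_nonneg (by positivity), ENNReal.ofReal_mul hr0, mul_assoc]

end IsHomogeneousKernel
end

section
variable {E : Type*} [NormedAddCommGroup E] [NormedSpace ℝ E] [FiniteDimensional ℝ E]
  {W : Type*} [NormedAddCommGroup W] [NormedSpace ℝ W] [FiniteDimensional ℝ W]
namespace IsHomogeneousKernel
variable {K : E → W →L[ℝ] W} (hK : IsHomogeneousKernel K)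
  [MeasurableSpace E] [BorelSpace E] (μ : Measure E) [μ.IsAddHaarMeasure]
include hK

theorem lintegral_indicator_enorm_rpow_ne_top (hm : 0 < Module.finrank ℝ E) {ε : ℝ} (hε : 0 < ε)
    {q : ℝ} (hq : 1 < q) :
    ∫⁻ u, ({u : E | ε < ‖u‖}.indicator (fun u => ‖K u‖ₑ) u) ^ q ∂μ ≠ ∞ := by
  obtain ⟨M, hM0, hM⟩ := hK.exists_norm_le
  set m := Module.finrank ℝ E
  have hq0 : 0 < q := by linarith
  set B : ℝ := M * (1 + ε⁻¹) ^ m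
  have hB : 0 ≤ B := by positivity
  refine ne_top_of_le_ne_top (b := ENNReal.ofReal (B ^ q) *
    ∫⁻ u : E, ENNReal.ofReal ((1 + ‖u‖) ^ (-(m * q))) ∂μ)
    (ENNReal.mul_ne_top (by simp) (finite_integral_one_add_norm ?_).ne) ?_
  · exact lt_mul_of_one_lt_right (by exact_mod_cast hm) hq
  rw [← lintegral_const_mul' _ _ (by simp)]
  refine lintegral_mono fun u => ?_
  simp only [Set.indicator_apply, Set.mem_ofPred_eq]
  split_ifs with hu
  · have hun : 0 < ‖u‖ := hε.trans hu
    have h1 : ‖K u‖ ≤ B * ((1 + ‖u‖) ^ m)⁻¹ := by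
      refine (hM u (norm_pos_iff.1 hun)).trans ?_
      rw [mul_assoc]
      gcongr
      rw [← div_eq_mul_inv, ← div_pow, ← inv_pow]
      gcongr
      rw [le_div_iff₀ (by positivity)]
      have : ‖u‖⁻¹ ≤ ε⁻¹ := by gcongr
      calc ‖u‖⁻¹ * (1 + ‖u‖) = 1 + ‖u‖⁻¹ := by field_simp; ring
        _ ≤ _ := by gcongr
    rw [← ENNReal.ofReal_mul (by positivity), ← ofReal_norm,
      ENNReal.ofReal_rpow_of_nonneg (norm_nonneg _) hq0.le]
    refine ENNReal.ofReal_le_ofReal ((Real.rpow_le_rpow (norm_nonneg _) h1 hq0.le).trans_eq ?_)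
    rw [Real.mul_rpow hB (by positivity), Real.rpow_neg (by positivity),
      Real.rpow_mul (by positivity), Real.rpow_natCast, Real.inv_rpow (by positivity)]
  · simp [hq0]

/-- Hölder bound for the truncated singular integral. -/
theorem exists_lintegral_truncConv_le (hm : 0 < Module.finrank ℝ E) {ε : ℝ} (hε : 0 < ε)
    {p : ℝ≥0∞} (hp : 1 < p) (hp' : p < ∞) :
    ∃ N : ℝ≥0∞, N ≠ ∞ ∧ ∀ g : E → W, AEStronglyMeasurable g μ → ∀ x,
      ∫⁻ u, ‖{u : E | ε < ‖u‖}.indicator (fun u => K u (g (x - u))) u‖ₑ ∂μ ≤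
        N * eLpNorm g p μ := by
  have hp0 : p ≠ 0 := (zero_lt_one.trans hp).ne'
  have hpr : 1 < p.toReal := by
    rw [← ENNReal.toReal_one]; exact (ENNReal.toReal_lt_toReal (by simp) hp'.ne).2 hp
  set q := p.toReal / (p.toReal - 1)
  have hpq : q.HolderConjugate p.toReal := (Real.HolderConjugate.conjExponent hpr).symm
  refine ⟨(∫⁻ u, ({u : E | ε < ‖u‖}.indicator (fun u => ‖K u‖ₑ) u) ^ q ∂μ) ^ (1 / q),
    ENNReal.rpow_ne_top_of_nonneg (by have := hpq.pos; positivity)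
      (hK.lintegral_indicator_enorm_rpow_ne_top μ hm hε hpq.lt), fun g hg x => ?_⟩
  have hmp := Measure.measurePreserving_sub_left μ x
  have hgx : AEStronglyMeasurable (fun u => g (x - u)) μ := hg.comp_measurePreserving hmp
  have e : eLpNorm g p μ = (∫⁻ u, ‖g (x - u)‖ₑ ^ p.toReal ∂μ) ^ (1 / p.toReal) := by
    rw [← eLpNorm_comp_measurePreserving hg hmp,
      eLpNorm_eq_lintegral_rpow_enorm_toReal hp0 hp'.ne]
    rfl
  rw [e]
  refine le_trans (lintegral_mono fun u => ?_) (ENNReal.lintegral_mul_le_Lp_mul_Lq μ hpq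
    (f := {u : E | ε < ‖u‖}.indicator (fun u => ‖K u‖ₑ)) (g := fun u => ‖g (x - u)‖ₑ) ?_ hgx.enorm)
  · simp only [Set.indicator_apply, Pi.mul_apply]
    split_ifs with hu
    · exact (K u).le_opENorm _
    · simp
  · exact ((hK.stronglyMeasurable.enorm).indicator
      (measurableSet_lt measurable_const measurable_norm)).aemeasurable

theorem integrable_truncConv (hm : 0 < Module.finrank ℝ E) {ε : ℝ} (hε : 0 < ε)
    {p : ℝ≥0∞} (hp : 1 < p) (hp' : p < ∞) {g : E → W} (hg : MemLp g p μ) (x : E) :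
    Integrable ({u : E | ε < ‖u‖}.indicator (fun u => K u (g (x - u)))) μ := by
  obtain ⟨N, hN, h⟩ := hK.exists_lintegral_truncConv_le μ hm hε hp hp'
  refine ⟨?_, (h g hg.1 x).trans_lt (ENNReal.mul_lt_top hN.lt_top hg.2)⟩
  refine AEStronglyMeasurable.indicator ?_ (measurableSet_lt measurable_const measurable_norm)
  exact isBoundedBilinearMap_apply.continuous.comp_aestronglyMeasurable
    (hK.stronglyMeasurable.aestronglyMeasurable.prodMk
      (hg.1.comp_measurePreserving (Measure.measurePreserving_sub_left μ x)))

omit hK in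
theorem truncConv_congr {f g : E → W} (h : f =ᵐ[μ] g) (ε : ℝ) :
    truncConv μ K ε f = truncConv μ K ε g := by
  ext x
  refine integral_congr_ae ?_
  filter_upwards [(Measure.measurePreserving_sub_left μ x).quasiMeasurePreserving.ae_eq_comp h] with u hu
  simp only [Function.comp] at hu
  simp [Set.indicator_apply, hu]

theorem truncConv_add (hm : 0 < Module.finrank ℝ E) {ε : ℝ} (hε : 0 < ε)
    {p : ℝ≥0∞} (hp : 1 < p) (hp' : p < ∞) {f g : E → W} (hf : MemLp f p μ) (hg : MemLp g p μ) :
    truncConv μ K ε (f + g) = truncConv μ K ε f + truncConv μ K ε g := by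
  ext x
  rw [Pi.add_apply, truncConv, truncConv, truncConv,
    ← integral_add (hK.integrable_truncConv μ hm hε hp hp' hf x)
      (hK.integrable_truncConv μ hm hε hp hp' hg x)]
  congr 1; ext u
  simp only [Set.indicator_apply, Pi.add_apply, map_add]
  split_ifs <;> simp

theorem truncConv_sub (hm : 0 < Module.finrank ℝ E) {ε : ℝ} (hε : 0 < ε)
    {p : ℝ≥0∞} (hp : 1 < p) (hp' : p < ∞) {f g : E → W} (hf : MemLp f p μ) (hg : MemLp g p μ) :
    truncConv μ K ε (f - g) = truncConv μ K ε f - truncConv μ K ε g := by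
  rw [eq_sub_iff_add_eq, ← hK.truncConv_add μ hm hε hp hp' (hf.sub hg) hg, sub_add_cancel]

/-- The truncated singular integrals are uniformly bounded on `Lᵖ`. -/
theorem exists_eLpNorm_truncConv_le_of_memLp (hm : Odd (Module.finrank ℝ E)) {p : ℝ≥0∞}
    (hp : 1 < p) (hp' : p < ∞) : ∃ C : ℝ≥0∞, C ≠ ∞ ∧ ∀ ε : ℝ, 0 < ε → ∀ f : E → W,
      StronglyMeasurable f → MemLp f p μ →
        eLpNorm (truncConv μ K ε f) p μ ≤ C * eLpNorm f p μ := by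
  obtain ⟨C, hC, hCb⟩ := hK.exists_eLpNorm_truncConv_le μ hm hp hp'
  refine ⟨C, hC, fun ε hε f hfm hf => ?_⟩
  obtain ⟨N, hN, hNb⟩ := hK.exists_lintegral_truncConv_le μ hm.pos hε hp hp'
  have ha : ∀ k : ℕ, ∃ g : E → W, HasCompactSupport g ∧
      eLpNorm (f - g) p μ ≤ ((k : ℝ≥0∞) + 1)⁻¹ ∧ Continuous g ∧ MemLp g p μ := fun k =>
    hf.exists_hasCompactSupport_eLpNorm_sub_le hp'.ne (by simp)
  choose g hgc hgf hg hgm using ha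
  have hinv : Filter.Tendsto (fun k : ℕ => ((k : ℝ≥0∞) + 1)⁻¹) Filter.atTop (nhds 0) := by
    have := (ENNReal.tendsto_inv_nat_nhds_zero).comp (Filter.tendsto_add_atTop_nat 1)
    simpa [Function.comp_def] using this
  have hlim : ∀ x, Filter.Tendsto (fun k => truncConv μ K ε (g k) x) Filter.atTop
      (nhds (truncConv μ K ε f x)) := by
    intro x
    rw [tendsto_iff_edist_tendsto_0]
    have h2 : Filter.Tendsto (fun k : ℕ => N * ((k : ℝ≥0∞) + 1)⁻¹) Filter.atTop (nhds 0) := by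
      simpa using ENNReal.Tendsto.const_mul hinv (.inr hN)
    refine tendsto_of_tendsto_of_tendsto_of_le_of_le tendsto_const_nhds h2
      (fun _ => zero_le) fun k => ?_
    simp only
    rw [edist_comm, edist_eq_enorm_sub, ← Pi.sub_apply,
      ← hK.truncConv_sub μ hm.pos hε hp hp' hf (hgm k)]
    exact (enorm_integral_le_lintegral_enorm _).trans
      ((hNb _ (hf.1.sub (hgm k).1) x).trans (by gcongr; exact hgf k))
  refine (Lp.eLpNorm_lim_le_liminf_eLpNorm
    (fun k => (hK.stronglyMeasurable_truncConv μ (hg k).stronglyMeasurable ε).aestronglyMeasurable)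
    _ (.of_forall hlim)).trans ?_
  have h3 : Filter.Tendsto (fun k : ℕ => C * (eLpNorm f p μ + ((k : ℝ≥0∞) + 1)⁻¹)) Filter.atTop
      (nhds (C * (eLpNorm f p μ + 0))) :=
    ENNReal.Tendsto.const_mul (tendsto_const_nhds.add hinv) (.inr hC)
  rw [add_zero] at h3
  refine (Filter.liminf_le_liminf (.of_forall fun k => ?_)).trans_eq h3.liminf_eq
  refine (hCb ε hε (g k) (hg k) (hgc k)).trans ?_
  gcongr
  have : g k = f - (f - g k) := by simp
  rw [this]
  exact (eLpNorm_sub_le hf.1 (hf.1.sub (hgm k).1) hp.le).trans (by gcongr; exact hgf k)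

/-- The truncated singular integrals are Cauchy in `Lᵖ` as the truncation tends to zero. -/
theorem exists_eLpNorm_truncConv_sub_le_of_memLp (hm : Odd (Module.finrank ℝ E)) {p : ℝ≥0∞}
    (hp : 1 < p) (hp' : p < ∞) {f : E → W} (hfm : StronglyMeasurable f) (hf : MemLp f p μ)
    {η : ℝ≥0∞} (hη : η ≠ 0) : ∃ r : ℝ, 0 < r ∧ ∀ ε δ : ℝ, 0 < ε → 0 < δ → ε ≤ r → δ ≤ r →
      eLpNorm (truncConv μ K ε f - truncConv μ K δ f) p μ ≤ η := by
  obtain ⟨C, hC, hCb⟩ := hK.exists_eLpNorm_truncConv_le_of_memLp μ hm hp hp'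
  obtain ⟨θ, hθ, hθη⟩ : ∃ θ : ℝ, 0 < θ ∧ C * ENNReal.ofReal θ + C * ENNReal.ofReal θ ≤ η / 2 := by
    obtain ⟨θ, hθ, hlt⟩ := ENNReal.exists_nnreal_pos_mul_lt (ENNReal.mul_ne_top ENNReal.ofNat_ne_top hC)
      (ENNReal.half_pos hη).ne' (a := 2 * C)
    refine ⟨θ, hθ, le_of_eq_of_le ?_ hlt.le⟩
    rw [ENNReal.ofReal_coe_nnreal]
    ring
  obtain ⟨g, hgc, hgs, hgf⟩ := hf.exist_eLpNorm_sub_le hp'.ne hp.le hθ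
  have hg := hgs.continuous
  have hgm : MemLp g p μ := hg.memLp_of_hasCompactSupport hgc
  obtain ⟨L, hL⟩ := hgs.lipschitzWith_of_hasCompactSupport hgc (by simp)
  obtain ⟨D, hD, hDb⟩ := hK.exists_eLpNorm_truncConv_sub_le μ hm hg hgc
    (L := L) (fun x y => by simpa [dist_eq_norm] using hL.dist_le_mul x y) p
  obtain ⟨r, hr, hrD, hr1⟩ : ∃ r : ℝ, 0 < r ∧ ENNReal.ofReal r * D ≤ η / 2 ∧ r ≤ 1 := by
    obtain ⟨r, hr, hlt⟩ := ENNReal.exists_nnreal_pos_mul_lt hD (ENNReal.half_pos hη).ne'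
    refine ⟨min r 1, by positivity, le_trans ?_ hlt.le, min_le_right _ _⟩
    gcongr
    rw [← ENNReal.ofReal_coe_nnreal]
    exact ENNReal.ofReal_le_ofReal (min_le_left _ _)
  refine ⟨r, hr, fun ε δ hε hδ hεr hδr => ?_⟩
  have hfg := hf.sub hgm
  have hfgm := hfm.sub hg.stronglyMeasurable
  have e : truncConv μ K ε f - truncConv μ K δ f =
      (truncConv μ K ε (f - g) - truncConv μ K δ (f - g)) +
        (truncConv μ K ε g - truncConv μ K δ g) := by
    rw [hK.truncConv_sub μ hm.pos hε hp hp' hf hgm, hK.truncConv_sub μ hm.pos hδ hp hp' hf hgm]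
    abel
  have hms : ∀ ε, ∀ h : E → W, StronglyMeasurable h →
      AEStronglyMeasurable (truncConv μ K ε h) μ := fun ε h hh =>
    (hK.stronglyMeasurable_truncConv μ hh ε).aestronglyMeasurable
  rw [e, ← ENNReal.add_halves η]
  refine (eLpNorm_add_le ((hms _ _ hfgm).sub (hms _ _ hfgm))
    ((hms _ _ hg.stronglyMeasurable).sub (hms _ _ hg.stronglyMeasurable)) hp.le).trans
    (add_le_add (le_trans ?_ hθη) ((hDb r hr1 ε δ hε hδ hεr hδr).trans hrD))
  refine (eLpNorm_sub_le (hms _ _ hfgm) (hms _ _ hfgm) hp.le).trans (add_le_add ?_ ?_)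
  · exact (hCb ε hε _ hfgm hfg).trans (by gcongr)
  · exact (hCb δ hδ _ hfgm hfg).trans (by gcongr)

end IsHomogeneousKernel
end

section
variable {E : Type*} [NormedAddCommGroup E] [NormedSpace ℝ E] [FiniteDimensional ℝ E]
  {W : Type*} [NormedAddCommGroup W] [NormedSpace ℂ W] [FiniteDimensional ℝ W]
  [MeasurableSpace E] [BorelSpace E] (μ : Measure E) [μ.IsAddHaarMeasure]
  {K : E → W →L[ℂ] W} (hK : IsHomogeneousKernel fun u => (K u).restrictScalars ℝ)
namespace IsHomogeneousKernel
include hK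

theorem exists_clm_truncConv (hm : Odd (Module.finrank ℝ E)) {p : ℝ≥0∞} [Fact (1 ≤ p)]
    (hp : 1 < p) (hp' : p < ∞) {ε : ℝ} (hε : 0 < ε) :
    ∃ T : Lp W p μ →L[ℂ] Lp W p μ, ∀ f : Lp W p μ,
      T f =ᵐ[μ] truncConv μ (fun u => (K u).restrictScalars ℝ) ε f := by
  obtain ⟨C, hC, hCb⟩ := hK.exists_eLpNorm_truncConv_le_of_memLp μ hm hp hp'
  have hb (f : Lp W p μ) := hCb ε hε f (Lp.stronglyMeasurable f) (Lp.memLp f)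
  have hmem (f : Lp W p μ) : MemLp (truncConv μ (fun u => (K u).restrictScalars ℝ) ε f) p μ :=
    ⟨(hK.stronglyMeasurable_truncConv μ (Lp.stronglyMeasurable f) ε).aestronglyMeasurable,
      (hb f).trans_lt (ENNReal.mul_lt_top hC.lt_top (Lp.eLpNorm_lt_top f))⟩
  refine ⟨LinearMap.mkContinuous
    { toFun f := (hmem f).toLp _
      map_add' f g := ?_
      map_smul' c f := ?_ } C.toReal fun f => ?_, fun f => (hmem f).coeFn_toLp⟩
  · rw [← MemLp.toLp_add, MemLp.toLp_eq_toLp_iff, truncConv_congr μ (Lp.coeFn_add f g),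
      hK.truncConv_add μ hm.pos hε hp hp' (Lp.memLp f) (Lp.memLp g)]
  · rw [RingHom.id_apply, ← MemLp.toLp_const_smul, MemLp.toLp_eq_toLp_iff,
      truncConv_congr μ (Lp.coeFn_smul c f)]
    refine .of_forall fun x => ?_
    rw [Pi.smul_apply, truncConv, truncConv, ← integral_smul]
    congr 1; ext u
    simp only [Set.indicator_apply, Pi.smul_apply, ContinuousLinearMap.coe_restrictScalars']
    split_ifs <;> simp
  · change ‖(hmem f).toLp _‖ ≤ _
    rw [Lp.norm_toLp, Lp.norm_def, ← ENNReal.toReal_mul]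
    exact ENNReal.toReal_mono (ENNReal.mul_ne_top hC (Lp.eLpNorm_lt_top f).ne) (hb f)

/-- Truncated singular integrals with an odd homogeneous kernel of critical degree converge in `Lᵖ`
to a bounded operator. -/
theorem exists_clm_tendsto_truncConv (hm : Odd (Module.finrank ℝ E)) {p : ℝ≥0∞} [Fact (1 ≤ p)]
    (hp : 1 < p) (hp' : p < ∞) :
    ∃ T : Lp W p μ →L[ℂ] Lp W p μ, ∀ f : Lp W p μ, Filter.Tendsto (fun ε : ℝ =>
      eLpNorm (fun x => truncConv μ (fun u => (K u).restrictScalars ℝ) ε f x - T f x) p μ)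
      (nhdsWithin 0 (Set.Ioi 0)) (nhds 0) := by
  have : CompleteSpace W := FiniteDimensional.complete ℝ W
  have hT (ε : ℝ) : ∃ T : Lp W p μ →L[ℂ] Lp W p μ, 0 < ε → ∀ f : Lp W p μ,
      T f =ᵐ[μ] truncConv μ (fun u => (K u).restrictScalars ℝ) ε f := by
    by_cases hε : 0 < ε
    · exact (hK.exists_clm_truncConv μ hm hp hp' hε).imp fun T h _ => h
    · exact ⟨0, fun h => absurd h hε⟩
  choose T hT using hT
  have hlim (f : Lp W p μ) : ∃ g, Filter.Tendsto (fun ε => T ε f) (nhdsWithin 0 (Set.Ioi 0))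
      (nhds g) := by
    rw [← cauchy_map_iff_exists_tendsto, EMetric.cauchy_iff]
    refine ⟨Filter.map_neBot.ne, fun η hη => ?_⟩
    obtain ⟨η', hη', hlt⟩ := exists_between hη
    obtain ⟨r, hr, h⟩ := hK.exists_eLpNorm_truncConv_sub_le_of_memLp μ hm hp hp'
      (Lp.stronglyMeasurable f) (Lp.memLp f) hη'.ne'
    refine ⟨_, Filter.image_mem_map (Ioc_mem_nhdsGT hr), ?_⟩
    rintro _ ⟨ε, hε, rfl⟩ _ ⟨δ, hδ, rfl⟩
    refine lt_of_le_of_lt ?_ hlt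
    rw [Lp.edist_def, eLpNorm_congr_ae ((hT ε hε.1 f).sub (hT δ hδ.1 f))]
    exact h ε δ hε.1 hδ.1 hε.2 hδ.2
  choose S hS using hlim
  refine ⟨continuousLinearMapOfTendsto T (f := S) (tendsto_pi_nhds.2 hS), fun f => ?_⟩
  have h := tendsto_iff_edist_tendsto_0.1 (hS f)
  refine h.congr' (eventually_mem_nhdsWithin.mono fun ε hε => ?_)
  rw [Lp.edist_def]
  exact eLpNorm_congr_ae ((hT ε hε f).sub .rfl)

end IsHomogeneousKernel
end

section
variable {F : Type*} [NormedAddCommGroup F] [NormedSpace ℝ F] [MeasurableSpace F] [BorelSpace F]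
  {V : Submodule ℝ F} [FiniteDimensional ℝ V]
  {W : Type*} [NormedAddCommGroup W] [NormedSpace ℂ W] [FiniteDimensional ℝ W]
  (μ : Measure V) [μ.IsAddHaarMeasure] {K : F → W →L[ℂ] W}

theorem IsHomogeneousKernel.exists_clm_tendsto_setIntegral_map
    (hK : IsHomogeneousKernel fun u : V => (K u).restrictScalars ℝ)
    (hm : Odd (Module.finrank ℝ V)) {p : ℝ≥0∞} [Fact (1 ≤ p)] (hp : 1 < p) (hp' : p < ∞)
    {π : F → V} (hπ : Measurable π) (hπV : ∀ v : V, π v = v) :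
    ∃ T : Lp W p (μ.map Subtype.val) →L[ℂ] Lp W p (μ.map Subtype.val),
      ∀ f : Lp W p (μ.map Subtype.val), Filter.Tendsto (fun ε : ℝ => eLpNorm (fun z : F =>
        (∫ w in {w : F | ε < ‖w - z‖}, K (z - w) (f w) ∂μ.map Subtype.val) - T f z) p (μ.map Subtype.val))
        (nhdsWithin 0 (Set.Ioi 0)) (nhds 0) := by
  have hemb : MeasurableEmbedding (Subtype.val : V → F) :=
    MeasurableEmbedding.subtype_coe V.closed_of_finiteDimensional.measurableSet
  have hval : MeasurePreserving (Subtype.val : V → F) μ (μ.map Subtype.val) := ⟨measurable_subtype_coe, rfl⟩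
  have hπμ : MeasurePreserving π (μ.map Subtype.val) μ := by
    refine ⟨hπ, ?_⟩
    rw [Measure.map_map hπ measurable_subtype_coe]
    simp [Function.comp_def, hπV]
  obtain ⟨T, hT⟩ := hK.exists_clm_tendsto_truncConv μ hm (p := p) hp hp'
  set A := (Lp.compMeasurePreservingₗᵢ (E := W) (p := p) ℂ _ hval).toContinuousLinearMap with hA
  set B := (Lp.compMeasurePreservingₗᵢ (E := W) (p := p) ℂ _ hπμ).toContinuousLinearMap with hB
  refine ⟨B ∘L T ∘L A, fun f => (hT (A f)).congr fun ε => ?_⟩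
  have hAf : (A f : V → W) =ᵐ[μ] fun v => f (v : F) := Lp.coeFn_compMeasurePreserving f hval
  have hBf : (fun v : V => (B (T (A f))) (v : F)) =ᵐ[μ] T (A f) := by
    filter_upwards [hval.quasiMeasurePreserving.ae_eq_comp
      (Lp.coeFn_compMeasurePreserving (T (A f)) hπμ)] with v hv
    simp only [Function.comp_apply, hπV] at hv
    exact hv
  rw [hemb.eLpNorm_map_measure]
  refine eLpNorm_congr_ae ?_
  filter_upwards [hBf] with x hx
  simp only [Function.comp_apply, ContinuousLinearMap.comp_apply]
  rw [hx, hemb.setIntegral_map, truncConv_congr μ hAf, truncConv,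
    ← integral_sub_left_eq_self _ μ x, ← integral_indicator]
  · classical
    congr 2; ext w
    rw [Set.indicator_apply, Set.indicator_apply, sub_sub_cancel]
    refine if_congr ?_ rfl rfl
    rw [Set.mem_ofPred_eq, norm_sub_rev]
    rfl
  · exact hemb.measurable (measurableSet_lt measurable_const (by fun_prop))
end

theorem ExteriorAlgebra.finiteDimensional (k M : Type*) [Field k] [AddCommGroup M] [Module k M]
    [FiniteDimensional k M] : FiniteDimensional k (ExteriorAlgebra k M) := by
  have hbot : ∀ i, Module.finrank k M < i → ⋀[k]^i M = ⊥ := fun i hi => by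
    rw [← Submodule.finrank_eq_zero, exteriorPower.finrank_eq, Nat.choose_eq_zero_of_lt hi]
  have htop : ⨆ i, ⋀[k]^i M = ⊤ :=
    (DirectSum.Decomposition.isInternal fun i : ℕ => ⋀[k]^i M).submodule_iSup_eq_top
  rw [FiniteDimensional, Module.finite_def, ← htop]
  have : ⨆ i, ⋀[k]^i M = ⨆ i : Fin (Module.finrank k M + 1), ⋀[k]^(i : ℕ) M := by
    refine le_antisymm (iSup_le fun i => ?_) (iSup_le fun i => le_iSup (fun i : ℕ => ⋀[k]^i M) i)
    by_cases hi : i < Module.finrank k M + 1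
    · exact le_iSup (fun i : Fin (Module.finrank k M + 1) => ⋀[k]^(i : ℕ) M) ⟨i, hi⟩
    · rw [hbot i (by omega)]
      exact bot_le
  rw [this]
  exact Submodule.fg_iSup _ fun i => Module.Finite.iff_fg.1 inferInstance

theorem CliffordAlgebra.finiteDimensional {k M : Type*} [Field k] [Invertible (2 : k)]
    [AddCommGroup M] [Module k M] [FiniteDimensional k M] (Q : QuadraticForm k M) :
    FiniteDimensional k (CliffordAlgebra Q) :=
  have := ExteriorAlgebra.finiteDimensional k M
  (equivExterior Q).symm.finiteDimensional

theorem sC_real_smul (n : ℕ) (t : ℝ) (z : Cn n) : sC n (t • z) = (t : ℂ) ^ 2 * sC n z := by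
  simp [sC, mul_pow, Finset.mul_sum]

theorem continuous_sC (n : ℕ) : Continuous (sC n) := by
  unfold sC
  fun_prop

section
variable {W : Type*} [NormedAddCommGroup W] [NormedSpace ℂ W] [FiniteDimensional ℂ W]

omit [FiniteDimensional ℂ W] in
/-- A Cauchy-type kernel with values in operators, homogeneous of degree `1 - n`. -/
theorem isHomogeneousKernel_sC_inv_smul {n : ℕ} (hn : 2 ≤ n) (heven : Even n)
    (V : Submodule ℝ (Cn n)) (hdim : Module.finrank ℝ V = n - 1)
    (hnull : ∀ v : Cn n, v ∈ V → v ≠ 0 → sC n v ≠ 0) (Φ : Cn n →ₗ[ℂ] W →L[ℂ] W) :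
    IsHomogeneousKernel fun u : V =>
      ((sC n u ^ (n / 2))⁻¹ • Φ u : W →L[ℂ] W).restrictScalars ℝ where
  continuousOn := by
    have hΦ : Continuous Φ := LinearMap.continuous_of_finiteDimensional Φ
    have hs : ContinuousOn (fun u : V => (sC n u ^ (n / 2))⁻¹) {0}ᶜ :=
      (((continuous_sC n).comp continuous_subtype_val).pow _).continuousOn.inv₀ fun u hu =>
        pow_ne_zero _ (hnull u u.2 (by simpa using hu))
    exact (ContinuousLinearMap.continuous_restrictScalars ℝ).comp_continuousOn
      (hs.smul (hΦ.comp continuous_subtype_val).continuousOn)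
  map_smul t u ht := by
    obtain ⟨m, rfl⟩ := heven
    have hm : m + m = (m + m - 1) + 1 := by omega
    have hd : (m + m) / 2 = m := by omega
    have ht' : (t : ℂ) ≠ 0 := by exact_mod_cast ht
    have hc : (((t : ℂ) ^ 2 * sC (m + m) u) ^ m)⁻¹ * t =
        ((t : ℂ) ^ (m + m - 1))⁻¹ * (sC (m + m) u ^ m)⁻¹ := by
      rw [mul_pow, mul_inv, ← pow_mul, two_mul]
      nth_rw 1 [hm]
      rw [pow_succ]
      field_simp
    have hΦ : Φ (t • (u : Cn (m + m))) = (t : ℂ) • Φ u := by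
      rw [← Φ.map_smul]; rfl
    ext w
    rw [hdim, hd, Submodule.coe_smul, sC_real_smul, hΦ, smul_smul, hc, mul_smul]
    simp only [ContinuousLinearMap.coe_restrictScalars', smul_apply]
    rw [← Complex.coe_smul]
    push_cast
    rfl

theorem exists_clm_tendsto_cauchy {n : ℕ} (hn : 2 ≤ n) (heven : Even n)
    {p : ℝ≥0∞} [Fact (1 ≤ p)] (hp : 1 < p) (hp' : p < ∞)
    (V : Submodule ℝ (Cn n)) (hdim : Module.finrank ℝ V = n - 1)
    (hnull : ∀ v : Cn n, v ∈ V → v ≠ 0 → sC n v ≠ 0) (φ : Cn n →ₗ[ℂ] W →ₗ[ℂ] W) :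
    ∃ T : Lp W p (μV n V) →L[ℂ] Lp W p (μV n V), ∀ f : Lp W p (μV n V),
      Filter.Tendsto (fun ε : ℝ => eLpNorm (fun z : Cn n =>
        (∫ w in {w : Cn n | ε < ‖w - z‖}, (sC n (z - w) ^ (n / 2))⁻¹ • φ (z - w) (f w) ∂μV n V)
          - T f z) p (μV n V))
        (nhdsWithin 0 (Set.Ioi 0)) (nhds 0) := by
  have : FiniteDimensional ℝ W := Module.Finite.trans ℂ W
  have : FiniteDimensional ℝ (Cn n) := Module.Finite.trans ℂ (Cn n)
  have hμ : μV n V = (μH[Module.finrank ℝ V] : Measure V).map Subtype.val := by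
    have h1 : ((n - 1 : ℕ) : ℝ) = (n : ℝ) - 1 := by rw [Nat.cast_sub (by omega)]; simp
    rw [isometry_subtype_coe.map_hausdorffMeasure (.inl (by positivity)), Subtype.range_coe,
      hdim, h1]
    rfl
  have hodd : Odd (Module.finrank ℝ V) := by
    rw [hdim]
    exact Nat.Even.sub_odd (by omega) heven odd_one
  obtain ⟨π, hπ⟩ := V.subtype.exists_leftInverse_of_injective V.ker_subtype
  rw [hμ]
  exact (isHomogeneousKernel_sC_inv_smul hn heven V hdim hnull
    (LinearMap.toContinuousLinearMap.toLinearMap ∘ₗ φ)).exists_clm_tendsto_setIntegral_map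
      (K := fun z => (sC n z ^ (n / 2))⁻¹ •
        (LinearMap.toContinuousLinearMap.toLinearMap ∘ₗ φ : Cn n →ₗ[ℂ] W →L[ℂ] W) z)
      μH[Module.finrank ℝ V] hodd hp hp'
      (LinearMap.continuous_of_finiteDimensional π).measurable (LinearMap.congr_fun hπ)
end

/-- For `n ≥ 2` even and `1 < p < ∞`, for a real `(n-1)`-dimensional
subspace `V ⊆ ℂⁿ` with `s(v) ≠ 0` for all nonzero `v ∈ V`, and `ν ∈ ℂⁿ` with
`∑ vⱼ νⱼ = 0` for all `v ∈ V`, the truncated Cauchy integrals converge in `Lᵖ(μ)`-norm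
as `ε → 0⁺`, and the resulting principal value Cauchy transform is a bounded linear
operator `C_V : Lᵖ(V) → Lᵖ(V)`. -/
theorem lp_boundedness_of_principal_value_cauchy_transform
    (n : ℕ) (hn : 2 ≤ n) (heven : Even n)
    (p : ℝ≥0∞) [Fact (1 ≤ p)] (hp1 : 1 < p) (hp2 : p < ∞)
    (V : Submodule ℝ (Cn n)) (hdim : Module.finrank ℝ ↥V = n - 1)
    (hnull : ∀ v : Cn n, v ∈ V → v ≠ 0 → sC n v ≠ 0)
    (ν : Cn n) (hν : ∀ v : Cn n, v ∈ V → ∑ j, v j * ν j = 0)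
    (nrm : AddGroupNorm (Cl n))
    (hsm : ∀ (c : ℂ) (a : Cl n), nrm (c • a) = ‖c‖ * nrm a) :
    letI : NormedAddCommGroup (Cl n) := AddGroupNorm.toNormedAddCommGroup nrm
    letI : NormedSpace ℂ (Cl n) :=
      { norm_smul_le := fun c a => le_of_eq (hsm c a) }
    letI : MeasurableSpace (Cl n) := borel (Cl n)
    letI : BorelSpace (Cl n) := ⟨rfl⟩
    PVCauchyTransformBoundedOnLp n p V ν := by
  let _ : NormedAddCommGroup (Cl n) := AddGroupNorm.toNormedAddCommGroup nrm
  let _ : NormedSpace ℂ (Cl n) :=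
    { norm_smul_le := fun c a => le_of_eq (hsm c a) }
  let _ : MeasurableSpace (Cl n) := borel (Cl n)
  let _ : BorelSpace (Cl n) := ⟨rfl⟩
  have : Invertible (2 : ℂ) := invertibleOfNonzero two_ne_zero
  have : FiniteDimensional ℂ (Cl n) := CliffordAlgebra.finiteDimensional (Qf n)
  obtain ⟨T, hT⟩ := exists_clm_tendsto_cauchy (W := Cl n) hn heven hp1 hp2 V hdim hnull
    ((LinearMap.mul ℂ (Cl n)) ∘ₗ (LinearMap.mulRight ℂ (((ωn n : ℂ))⁻¹ • ιC n ν)) ∘ₗ ιC n)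
  refine ⟨T, fun f => (hT f).congr fun ε => ?_, ‖T‖ + 1, by positivity, fun f => ?_⟩
  · congr 1; ext z
    congr 1
    rw [truncCauchy, ← integral_smul]
    congr 1; ext w
    simp [Gc, smul_comm ((ωn n : ℂ))⁻¹]
  · exact (T.le_opNorm f).trans (by gcongr; linarith)
end
end

section
/- For n ≥ 2, the function G : ℝⁿ∖{0} → Cl_n(ℂ) defined by G(x) = ι(x)/‖x‖ⁿ (where ℝⁿ is embedded in ℂⁿ componentwise) is both left monogenic and right monogenic on ℝⁿ∖{0}; that is, Σ_{j=1}^n ι(e_j)·(∂G/∂x_j)(x) = 0 and Σ_{j=1}^n (∂G/∂x_j)(x)·ι(e_j) = 0 for all x ≠ 0. -/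
noncomputable section
open MeasureTheory
open scoped BigOperators ENNReal

/-- The `j`-th standard basis vector of ℂⁿ. -/
def eC (n : ℕ) (j : Fin n) : Cn n := EuclideanSpace.single j 1
/-- The `j`-th standard basis vector of ℝⁿ. -/
def eR (n : ℕ) (j : Fin n) : Rn n := EuclideanSpace.single j 1

/-- The componentwise embedding ℝⁿ → ℂⁿ. -/
def jmap (n : ℕ) (x : Rn n) : Cn n := (WithLp.equiv 2 (Fin n → ℂ)).symm fun i => (x i : ℂ)

/-- The Euclidean Cauchy kernel `G(x) = ι(x)/‖x‖ⁿ`, `x ∈ ℝⁿ ∖ {0} ⊆ ℂⁿ`. -/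
def Gr (n : ℕ) (x : Rn n) : Cl n := (((‖x‖ ^ n : ℝ) : ℂ))⁻¹ • ιC n (jmap n x)

/-- `f : ℝⁿ → Cl_n(ℂ)` is differentiable on `U` with coordinate partial derivatives
`Df x j = (∂f/∂x_j)(x)`, tested against all `ℂ`-linear functionals of the
(finite-dimensional) Clifford algebra. -/
def HasPartialDerivsOn (n : ℕ) (f : Rn n → Cl n) (Df : Rn n → Fin n → Cl n)
    (U : Set (Rn n)) : Prop :=
  ∀ φ : Cl n →ₗ[ℂ] ℂ, ∀ x ∈ U, DifferentiableAt ℝ (fun y => φ (f y)) x ∧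
    ∀ j : Fin n, fderiv ℝ (fun y => φ (f y)) x (eR n j) = φ (Df x j)

/-- `f` is left monogenic on `U`: it is differentiable and `∑ⱼ ι(eⱼ) · ∂f/∂xⱼ = 0` on `U`. -/
def IsLeftMonogenicOn (n : ℕ) (f : Rn n → Cl n) (U : Set (Rn n)) : Prop :=
  ∃ Df : Rn n → Fin n → Cl n, HasPartialDerivsOn n f Df U ∧
    ∀ x ∈ U, ∑ j, ιC n (eC n j) * Df x j = 0

/-- `f` is right monogenic on `U`: it is differentiable and `∑ⱼ (∂f/∂xⱼ) · ι(eⱼ) = 0` on `U`. -/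
def IsRightMonogenicOn (n : ℕ) (f : Rn n → Cl n) (U : Set (Rn n)) : Prop :=
  ∃ Df : Rn n → Fin n → Cl n, HasPartialDerivsOn n f Df U ∧
    ∀ x ∈ U, ∑ j, Df x j * ιC n (eC n j) = 0

/-- `F : ℂⁿ → Cl_n(ℂ)` is holomorphic on `Ω` with complex coordinate partial
derivatives `DF z j = (∂F/∂z_j)(z)`, tested against all `ℂ`-linear functionals. -/
def HasCPartialDerivsOn (n : ℕ) (F : Cn n → Cl n) (DF : Cn n → Fin n → Cl n)
    (Ω : Set (Cn n)) : Prop :=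
  ∀ φ : Cl n →ₗ[ℂ] ℂ, ∀ z ∈ Ω, DifferentiableAt ℂ (fun w => φ (F w)) z ∧
    ∀ j : Fin n, fderiv ℂ (fun w => φ (F w)) z (eC n j) = φ (DF z j)

/-- `F : ℂⁿ → Cl_n(ℂ)` is holomorphic (ℂ-differentiable) on `Ω`. -/
def IsHolomorphicOn (n : ℕ) (F : Cn n → Cl n) (Ω : Set (Cn n)) : Prop :=
  ∀ φ : Cl n →ₗ[ℂ] ℂ, ∀ z ∈ Ω, DifferentiableAt ℂ (fun w => φ (F w)) z

/-- `F` is complex left monogenic on `Ω`: holomorphic with `∑ⱼ ι(eⱼ) · ∂F/∂zⱼ = 0` on `Ω`. -/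
def IsCLeftMonogenicOn (n : ℕ) (F : Cn n → Cl n) (Ω : Set (Cn n)) : Prop :=
  ∃ DF : Cn n → Fin n → Cl n, HasCPartialDerivsOn n F DF Ω ∧
    ∀ z ∈ Ω, ∑ j, ιC n (eC n j) * DF z j = 0

/-- `F` is complex right monogenic on `Ω`: holomorphic with `∑ⱼ (∂F/∂zⱼ) · ι(eⱼ) = 0` on `Ω`. -/
def IsCRightMonogenicOn (n : ℕ) (F : Cn n → Cl n) (Ω : Set (Cn n)) : Prop :=
  ∃ DF : Cn n → Fin n → Cl n, HasCPartialDerivsOn n F DF Ω ∧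
    ∀ z ∈ Ω, ∑ j, DF z j * ιC n (eC n j) = 0

/-- The componentwise embedding ℝⁿ → ℂⁿ as an `ℝ`-linear map. -/
def jmapLinear (n : ℕ) : Rn n →ₗ[ℝ] Cn n where
  toFun := jmap n
  map_add' x y := by
    ext i
    simp [jmap]
  map_smul' c x := by
    ext i
    simp [jmap]

theorem jmap_eR (n : ℕ) (j : Fin n) : jmap n (eR n j) = eC n j := by
  ext i
  by_cases h : i = j <;> simp [jmap, eR, eC, h]

theorem Qf_apply (n : ℕ) (z : Cn n) : Qf n z = -∑ j, z j ^ 2 := by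
  simp [Qf, QuadraticMap.weightedSumSquares_apply, pow_two]

theorem Qf_eC (n : ℕ) (j : Fin n) : Qf n (eC n j) = -1 := by
  simp [Qf_apply, eC, ite_pow]

theorem Qf_jmap (n : ℕ) (x : Rn n) : Qf n (jmap n x) = -((‖x‖ ^ 2 : ℝ) : ℂ) := by
  rw [Qf_apply, EuclideanSpace.real_norm_sq_eq]
  simp [jmap]

theorem ιC_mul_self (n : ℕ) (z : Cn n) : ιC n z * ιC n z = Qf n z • 1 := by
  rw [ιC, CliffordAlgebra.ι_sq_scalar, Algebra.algebraMap_eq_smul_one]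

theorem sum_smul_ιC_eC (n : ℕ) (z : Cn n) : ∑ j, z j • ιC n (eC n j) = ιC n z := by
  simp_rw [← map_smul, ← map_sum]
  congr 1
  ext i
  simp [eC, Pi.single_apply]

theorem hasFDerivAt_inv_norm_pow {E : Type*} [NormedAddCommGroup E] [InnerProductSpace ℝ E]
    (n : ℕ) {x : E} (hx : x ≠ 0) :
    HasFDerivAt (fun y : E => (‖y‖ ^ n)⁻¹)
      ((-(n : ℝ) * (‖x‖ ^ (n + 2))⁻¹) • innerSL ℝ x) x := by
  have hx' : ‖x‖ ≠ 0 := norm_ne_zero_iff.mpr hx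
  have hnorm : HasFDerivAt (fun y : E => ‖y‖) (‖x‖⁻¹ • innerSL ℝ x) x := by
    have h := (hasStrictFDerivAt_norm_sq x).hasFDerivAt.sqrt (pow_ne_zero 2 hx')
    simp only [Real.sqrt_sq (norm_nonneg _)] at h
    convert h using 1
    ext v
    simp
    field_simp
  have h := ((hasDerivAt_pow n ‖x‖).inv (pow_ne_zero n hx')).comp_hasFDerivAt x hnorm
  refine h.congr_fderiv ?_
  rw [smul_smul]
  congr 1
  rcases n with _ | n
  · simp
  · simp only [Nat.add_sub_cancel]
    field_simp
    ring

/-- The `j`-th partial derivative of the Euclidean Cauchy kernel. -/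
def partialGr (n : ℕ) (x : Rn n) (j : Fin n) : Cl n :=
  (((‖x‖ ^ n : ℝ) : ℂ))⁻¹ • ιC n (eC n j)
    - ((n : ℂ) * (((‖x‖ ^ (n + 2) : ℝ) : ℂ))⁻¹) • (jmap n x j • ιC n (jmap n x))

theorem hasPartialDerivsOn_Gr (n : ℕ) :
    HasPartialDerivsOn n (Gr n) (partialGr n) {x : Rn n | x ≠ 0} := by
  intro φ x hx
  let ψ : Rn n →L[ℝ] ℂ := LinearMap.toContinuousLinearMap
    ((φ.comp (ιC n)).restrictScalars ℝ ∘ₗ jmapLinear n)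
  have hψ (y : Rn n) : ψ y = φ (ιC n (jmap n y)) := rfl
  have heq : (fun y => φ (Gr n y)) = fun y => (‖y‖ ^ n)⁻¹ • ψ y := by
    funext y
    rw [hψ, Gr, map_smul, ← Complex.ofReal_inv, Complex.coe_smul]
  have h := (hasFDerivAt_inv_norm_pow n hx).fun_smul (ψ.hasFDerivAt (x := x))
  rw [heq]
  refine ⟨h.differentiableAt, fun j => ?_⟩
  have hin : inner ℝ x (eR n j) = x j := by
    simp [eR, EuclideanSpace.inner_single_right]
  have hj : jmap n x j = (x j : ℂ) := rfl
  rw [h.fderiv]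
  simp only [add_apply, smul_apply,
    ContinuousLinearMap.smulRight_apply, innerSL_apply_apply, hin, hψ, jmap_eR, partialGr, map_sub,
    map_smul, hj, smul_eq_mul, Complex.real_smul]
  push_cast
  ring

theorem cauchyKernel_coeff_cancel (n : ℕ) {r : ℝ} (hr : r ≠ 0) :
    ((r ^ n : ℝ) : ℂ)⁻¹ * -(n : ℂ)
      - (n : ℂ) * ((r ^ (n + 2) : ℝ) : ℂ)⁻¹ * -((r ^ 2 : ℝ) : ℂ) = 0 := by
  have : (r : ℂ) ≠ 0 := Complex.ofReal_ne_zero.mpr hr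
  push_cast
  field_simp
  ring

theorem sum_ιC_eC_mul_self (n : ℕ) :
    ∑ j, ιC n (eC n j) * ιC n (eC n j) = (-(n : ℂ)) • (1 : Cl n) := by
  simp only [ιC_mul_self, Qf_eC, Finset.sum_const, Finset.card_univ, Fintype.card_fin]
  module

theorem sum_ιC_eC_mul_partialGr (n : ℕ) {x : Rn n} (hx : x ≠ 0) :
    ∑ j, ιC n (eC n j) * partialGr n x j = 0 := by
  simp only [partialGr, mul_sub, mul_smul_comm, Finset.sum_sub_distrib, ← Finset.smul_sum]
  simp only [← smul_mul_assoc, ← Finset.sum_mul]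
  rw [sum_smul_ιC_eC]
  simp only [smul_mul_assoc]
  rw [sum_ιC_eC_mul_self, ιC_mul_self, Qf_jmap, smul_smul, smul_smul, ← sub_smul,
    cauchyKernel_coeff_cancel n (norm_ne_zero_iff.mpr hx), zero_smul]

theorem sum_partialGr_mul_ιC_eC (n : ℕ) {x : Rn n} (hx : x ≠ 0) :
    ∑ j, partialGr n x j * ιC n (eC n j) = 0 := by
  simp only [partialGr, sub_mul, smul_mul_assoc, Finset.sum_sub_distrib, ← Finset.smul_sum]
  simp only [← mul_smul_comm, ← Finset.mul_sum]
  rw [sum_smul_ιC_eC]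
  simp only [mul_smul_comm]
  rw [sum_ιC_eC_mul_self, ιC_mul_self, Qf_jmap, smul_smul, smul_smul, ← sub_smul,
    cauchyKernel_coeff_cancel n (norm_ne_zero_iff.mpr hx), zero_smul]

/-- For `n ≥ 2`, the Euclidean Cauchy kernel `G(x) = ι(x)/‖x‖ⁿ` is both
left and right monogenic on `ℝⁿ ∖ {0}`. -/
theorem euclidean_cauchy_kernel_left_and_right_monogenic (n : ℕ) (hn : 2 ≤ n) :
    IsLeftMonogenicOn n (Gr n) {x : Rn n | x ≠ 0} ∧
    IsRightMonogenicOn n (Gr n) {x : Rn n | x ≠ 0} := by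
  exact ⟨⟨partialGr n, hasPartialDerivsOn_Gr n, fun _ hx => sum_ιC_eC_mul_partialGr n hx⟩,
    ⟨partialGr n, hasPartialDerivsOn_Gr n, fun _ hx => sum_partialGr_mul_ιC_eC n hx⟩⟩
end
end
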